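/- arXiv:2001.06761 — 10 statements merged into one kernel-verified Lean document; each statement's English description precedes it below -/
import Mathlib

section
/- Let A be a real n×n matrix and let α ⊆ {1,…,n} with |α| = 1, say α = {i}. Then A is an N-matrix if and only if the 1×1 matrix A[α] is an N-matrix (i.e., the diagonal entry a_{ii} < 0), the principal submatrix A[ᾱ] is an N-matrix, and the Schur complement A/A[α] = A[ᾱ] − A[ᾱ,α] A[α]⁻¹ A[α,ᾱ] is a P-matrix. -/
open Matrix

/-- A real matrix is an N-matrix if all of its principal minors are negative. -/
def IsNMatrix {m : Type*} [Fintype m] [DecidableEq m] (A : Matrix m m ℝ) : Prop :=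
  ∀ α : Finset m, α.Nonempty →
    (A.submatrix (fun i : α => (i : m)) (fun j : α => (j : m))).det < 0

/-- A real matrix is a P-matrix if all of its principal minors are positive. -/
def IsPMatrix {m : Type*} [Fintype m] [DecidableEq m] (A : Matrix m m ℝ) : Prop :=
  ∀ α : Finset m, α.Nonempty →
    0 < (A.submatrix (fun i : α => (i : m)) (fun j : α => (j : m))).det

theorem minor_reindex {m κ : Type} [Fintype m] [DecidableEq m] [Fintype κ] [DecidableEq κ]
    (A : Matrix m m ℝ) (f : κ → m) (hf : Function.Injective f) (α : Finset m)
    (hα : ∀ x, x ∈ α ↔ ∃ k, f k = x) :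
    (A.submatrix f f).det =
      (A.submatrix (fun i : α => (i : m)) (fun j : α => (j : m))).det := by
  let e : κ ≃ α := Equiv.ofBijective (fun k => ⟨f k, (hα _).2 ⟨k, rfl⟩⟩)
    ⟨fun a b h => hf (congrArg Subtype.val h), fun x => by
      obtain ⟨k, hk⟩ := (hα _).1 x.2
      exact ⟨k, Subtype.ext hk⟩⟩
  rw [← Matrix.det_submatrix_equiv_self e]
  rfl

theorem IsNMatrix.minor {m κ : Type} [Fintype m] [DecidableEq m] [Fintype κ] [DecidableEq κ]
    [Nonempty κ] {A : Matrix m m ℝ} (h : IsNMatrix A) (f : κ → m) (hf : Function.Injective f) :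
    (A.submatrix f f).det < 0 := by
  rw [minor_reindex A f hf (Finset.univ.image f) (by simp)]
  exact h _ (Finset.univ_nonempty.image f)

theorem IsPMatrix.minor {m κ : Type} [Fintype m] [DecidableEq m] [Fintype κ] [DecidableEq κ]
    [Nonempty κ] {A : Matrix m m ℝ} (h : IsPMatrix A) (f : κ → m) (hf : Function.Injective f) :
    0 < (A.submatrix f f).det := by
  rw [minor_reindex A f hf (Finset.univ.image f) (by simp)]
  exact h _ (Finset.univ_nonempty.image f)

theorem det_schur_single {m κ : Type} [Fintype κ] [DecidableEq κ]
    (A : Matrix m m ℝ) (i : m) (hi : A i i ≠ 0) (f : κ → m) :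
    (A.submatrix (Sum.elim (fun _ : Unit => i) f) (Sum.elim (fun _ : Unit => i) f)).det =
      A i i * (Matrix.of fun j k : κ =>
        A (f j) (f k) - A (f j) i * (A i i)⁻¹ * A i (f k)).det := by
  let D : Matrix Unit Unit ℝ := Matrix.of fun _ _ => A i i
  let D' : Matrix Unit Unit ℝ := Matrix.of fun _ _ => (A i i)⁻¹
  let _ : Invertible D := ⟨D', by ext; simp [D, D', Matrix.mul_apply, hi],
    by ext; simp [D, D', Matrix.mul_apply, hi]⟩
  have h := Matrix.det_fromBlocks₁₁ D (Matrix.of fun (_ : Unit) k => A i (f k))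
    (Matrix.of fun j (_ : Unit) => A (f j) i) (A.submatrix f f)
  have h1 : D.det = A i i := by simp [D]
  have h2 : ⅟D = D' := rfl
  rw [h1, h2] at h
  convert h using 2
  · ext (a | a) (b | b) <;> rfl
  · congr 1
    ext a b
    simp [D', Matrix.mul_apply]

/-- Theorem 3.2: for `α = {i}`, `A` is an N-matrix iff `A[α]` and `A[ᾱ]` are
N-matrices and the Schur complement `A/A[α]` is a P-matrix. -/
theorem stmt_0 {n : ℕ} (A : Matrix (Fin n) (Fin n) ℝ) (i : Fin n) :
    IsNMatrix A ↔
      A i i < 0 ∧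
      IsNMatrix (A.submatrix (fun j : {j : Fin n // j ≠ i} => (j : Fin n))
        (fun j : {j : Fin n // j ≠ i} => (j : Fin n))) ∧
      IsPMatrix (Matrix.of fun j k : {j : Fin n // j ≠ i} =>
        A (j : Fin n) (k : Fin n) - A (j : Fin n) i * (A i i)⁻¹ * A i (k : Fin n)) := by
  have inj : ∀ {κ : Type} (f : κ → Fin n), Function.Injective f → (∀ k, f k ≠ i) →
      Function.Injective (Sum.elim (fun _ : Unit => i) f) := by
    intro κ f hf hk
    exact Function.Injective.sumElim (fun _ _ _ => rfl) hf (fun _ b => (hk b).symm)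
  constructor
  · intro h
    have hi : A i i < 0 := by
      simpa using h.minor (fun _ : Unit => i) (fun _ _ _ => rfl)
    refine ⟨hi, ?_, ?_⟩
    · intro α hα
      have := hα.to_subtype
      exact h.minor (fun x : α => (x.1 : Fin n))
        (fun a b hab => Subtype.ext (Subtype.ext hab))
    · intro α hα
      have h1 := h.minor _ (inj (fun x : α => (x.1 : Fin n))
        (fun a b hab => Subtype.ext (Subtype.ext hab)) (fun k => k.1.2))
      rw [det_schur_single A i hi.ne] at h1
      exact pos_of_mul_neg_right h1 hi.le
  · rintro ⟨hi, hN, hP⟩ α hα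
    by_cases hm : i ∈ α
    · have hf : Function.Injective (fun x : α.erase i => (x : Fin n)) :=
        Subtype.val_injective
      have hne : ∀ x : α.erase i, (x : Fin n) ≠ i := fun x => Finset.ne_of_mem_erase x.2
      rw [← minor_reindex A _ (inj _ hf hne) α (by
        intro x
        by_cases hx : x = i
        · subst hx; simp [hm]
        · simp [hx, Ne.symm hx]), det_schur_single A i hi.ne]
      refine mul_neg_of_neg_of_pos hi ?_
      rcases isEmpty_or_nonempty (α.erase i) with he | he
      · rw [Matrix.det_isEmpty]; exact one_pos
      · exact hP.minor (fun x : α.erase i => ⟨x, hne x⟩)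
          (fun a b hab => Subtype.ext (Subtype.mk.inj hab))
    · have := hα.to_subtype
      exact hN.minor (fun x : α => ⟨x, fun hx => hm (hx ▸ x.2)⟩)
        (fun a b hab => Subtype.ext (Subtype.mk.inj hab))
end

section
/- Let A be a real n×n N-matrix of the second category (all entries of A are negative), let a ∈ ℝ, and let x, y ∈ ℝⁿ. Then the (n+1)×(n+1) bordered matrix U = [[A, x],[yᵀ, a]] is an N-matrix of the second category if and only if a < 0, x < 0, y < 0 (entrywise), and A − (1/a)·x·yᵀ is a P-matrix. -/
open Matrix

/-- The bordered matrix `U = [[A, x], [yᵀ, a]]`. -/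
def border {n : ℕ} (A : Matrix (Fin n) (Fin n) ℝ) (x y : Fin n → ℝ) (a : ℝ) :
    Matrix (Fin (n + 1)) (Fin (n + 1)) ℝ :=
  Matrix.of fun i j =>
    if hi : (i : ℕ) < n then
      if hj : (j : ℕ) < n then A ⟨i, hi⟩ ⟨j, hj⟩ else x ⟨i, hi⟩
    else
      if hj : (j : ℕ) < n then y ⟨j, hj⟩ else a

lemma det_sub_image {m κ : Type*} [Fintype m] [DecidableEq m] [Fintype κ] [DecidableEq κ]
    (M : Matrix m m ℝ) (g : κ → m) (hg : Function.Injective g) (α : Finset m)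
    (h : ∀ i, i ∈ α ↔ ∃ k, g k = i) :
    (M.submatrix (fun i : α => (i : m)) (fun j : α => (j : m))).det = (M.submatrix g g).det := by
  let f : κ → α := fun k => ⟨g k, (h _).2 ⟨k, rfl⟩⟩
  have hf : Function.Bijective f := by
    constructor
    · intro a b hab
      exact hg (congrArg Subtype.val hab)
    · rintro ⟨i, hi⟩
      obtain ⟨k, hk⟩ := (h i).1 hi
      exact ⟨k, Subtype.ext hk⟩
  rw [← Matrix.det_submatrix_equiv_self (Equiv.ofBijective f hf)]
  rfl

lemma border_det_last {n : ℕ} (A : Matrix (Fin n) (Fin n) ℝ) (x y : Fin n → ℝ) (a : ℝ)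
    (ha : a ≠ 0) (β : Finset (Fin n)) (α : Finset (Fin (n + 1)))
    (hl : Fin.last n ∈ α) (h : ∀ i : Fin n, i.castSucc ∈ α ↔ i ∈ β) :
    ((border A x y a).submatrix (fun i : α => (i : Fin (n + 1))) (fun j : α => (j : Fin (n + 1)))).det
      = a * ((Matrix.of fun i j : Fin n => A i j - (1 / a) * (x i * y j)).submatrix
          (fun i : β => (i : Fin n)) (fun j : β => (j : Fin n))).det := by
  let g : β ⊕ Unit → Fin (n + 1) := Sum.elim (fun i => (i : Fin n).castSucc) (fun _ => Fin.last n)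
  have hg : Function.Injective g := by
    rintro (i | i) (j | j) hij
    · exact congrArg Sum.inl (Subtype.ext (Fin.castSucc_injective _ hij))
    · exact absurd hij (Fin.castSucc_ne_last _)
    · exact absurd hij.symm (Fin.castSucc_ne_last _)
    · rfl
  rw [det_sub_image _ g hg α]
  · let D : Matrix Unit Unit ℝ := Matrix.diagonal fun _ => a
    letI : Invertible a := invertibleOfNonzero ha
    letI : Invertible D := ⟨Matrix.diagonal fun _ => a⁻¹, by simp [D, ha], by simp [D, ha]⟩
    have : (border A x y a).submatrix g g = Matrix.fromBlocks
        (A.submatrix (fun i : β => (i : Fin n)) (fun j : β => (j : Fin n)))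
        (Matrix.of fun (i : β) (_ : Unit) => x i) (Matrix.of fun (_ : Unit) (j : β) => y j) D := by
      ext (i | i) (j | j) <;> simp [border, g, D]
    rw [this, Matrix.det_fromBlocks₂₂]
    have hD : ⅟D = Matrix.diagonal fun _ => a⁻¹ := rfl
    rw [hD]
    congr 1
    · simp [D]
    · congr 1
      ext i j
      simp [Matrix.mul_apply]
      ring
  · intro i
    refine Fin.lastCases ?_ (fun i => ?_) i
    · exact ⟨fun _ => ⟨Sum.inr (), rfl⟩, fun _ => hl⟩
    · rw [h]
      constructor
      · intro hi
        exact ⟨Sum.inl ⟨i, hi⟩, rfl⟩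
      · rintro ⟨(k | k), hk⟩
        · have : (k : Fin n) = i := Fin.castSucc_injective _ hk
          exact this ▸ k.2
        · exact absurd hk.symm (Fin.castSucc_ne_last _)

lemma border_det_cast {n : ℕ} (A : Matrix (Fin n) (Fin n) ℝ) (x y : Fin n → ℝ) (a : ℝ)
    (β : Finset (Fin n)) (α : Finset (Fin (n + 1)))
    (hl : Fin.last n ∉ α) (h : ∀ i : Fin n, i.castSucc ∈ α ↔ i ∈ β) :
    ((border A x y a).submatrix (fun i : α => (i : Fin (n + 1))) (fun j : α => (j : Fin (n + 1)))).det
      = (A.submatrix (fun i : β => (i : Fin n)) (fun j : β => (j : Fin n))).det := by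
  rw [det_sub_image _ (fun i : β => (i : Fin n).castSucc) (fun i j hij =>
    Subtype.ext (Fin.castSucc_injective _ hij)) α]
  · congr 1
    ext i j
    simp [border]
  · intro i
    refine Fin.lastCases ?_ (fun i => ?_) i
    · exact ⟨fun hh => absurd hh hl, fun ⟨k, hk⟩ => absurd hk (Fin.castSucc_ne_last _)⟩
    · rw [h]
      constructor
      · intro hi
        exact ⟨⟨i, hi⟩, rfl⟩
      · rintro ⟨k, hk⟩
        have : (k : Fin n) = i := Fin.castSucc_injective _ hk
        exact this ▸ k.2

/-- Corollary 4.1: bordering an N-matrix of the second category. -/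
theorem stmt_1 {n : ℕ} (A : Matrix (Fin n) (Fin n) ℝ)
    (hA : IsNMatrix A) (hAneg : ∀ i j, A i j < 0) (a : ℝ) (x y : Fin n → ℝ) :
    (IsNMatrix (border A x y a) ∧ ∀ i j, border A x y a i j < 0) ↔
      a < 0 ∧ (∀ i, x i < 0) ∧ (∀ i, y i < 0) ∧
        IsPMatrix (Matrix.of fun i j : Fin n => A i j - (1 / a) * (x i * y j)) := by
  constructor
  · rintro ⟨hN, hneg⟩
    have ha : a < 0 := by simpa [border] using hneg (Fin.last n) (Fin.last n)
    refine ⟨ha, fun i => by simpa [border] using hneg i.castSucc (Fin.last n),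
      fun i => by simpa [border] using hneg (Fin.last n) i.castSucc, ?_⟩
    intro β _
    have h1 := hN (insert (Fin.last n) (β.map Fin.castSuccEmb)) (Finset.insert_nonempty _ _)
    rw [border_det_last A x y a ha.ne β _ (Finset.mem_insert_self _ _)
      (fun i => by simp [Fin.castSucc_ne_last])] at h1
    exact pos_of_mul_neg_right h1 ha.le
  · rintro ⟨ha, hx, hy, hP⟩
    constructor
    · intro α hα
      let β : Finset (Fin n) := Finset.univ.filter fun i => i.castSucc ∈ α
      have hβ : ∀ i : Fin n, i.castSucc ∈ α ↔ i ∈ β := fun i => by simp [β]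
      by_cases hl : Fin.last n ∈ α
      · rw [border_det_last A x y a ha.ne β α hl hβ]
        rcases β.eq_empty_or_nonempty with hb | hb
        · haveI : IsEmpty β := by rw [hb]; infer_instance
          rw [Matrix.det_isEmpty]
          linarith
        · exact mul_neg_of_neg_of_pos ha (hP β hb)
      · rw [border_det_cast A x y a β α hl hβ]
        apply hA
        obtain ⟨i, hi⟩ := hα
        induction i using Fin.lastCases with
        | last => exact absurd hi hl
        | cast i => exact ⟨i, (hβ i).1 hi⟩
    · intro i j
      induction i using Fin.lastCases with
      | last =>
        induction j using Fin.lastCases with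
        | last => simpa [border] using ha
        | cast j => simpa [border] using hy j
      | cast i =>
        induction j using Fin.lastCases with
        | last => simpa [border] using hx i
        | cast j => simpa [border] using hAneg i j
end

section
/- Let n ≥ 2 and let A be a real n×n N-matrix of the second category, partitioned as A = [[A', u],[vᵀ, a]] where A' is the leading (n−1)×(n−1) principal submatrix, u, v ∈ ℝⁿ⁻¹ and a ∈ ℝ. Then A' is an N-matrix of the second category, a < 0, u < 0 and v < 0 entrywise, and the Schur complement A' − (1/a)·u·vᵀ is a P-matrix. -/
open Matrix

theorem IsNMatrix.det_submatrix_neg {m ι : Type*} [Fintype m] [DecidableEq m] [Fintype ι]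
    [DecidableEq ι] [Nonempty ι] {A : Matrix m m ℝ} (hA : IsNMatrix A) (f : ι → m)
    (hf : Function.Injective f) : (A.submatrix f f).det < 0 := by
  have h := hA (Finset.univ.image f) (Finset.univ_nonempty.image f)
  let e : ι ≃ (Finset.univ.image f : Finset m) :=
    Equiv.ofBijective (fun i => ⟨f i, Finset.mem_image_of_mem f (Finset.mem_univ i)⟩) (by
      constructor
      · intro a b hab
        exact hf (congrArg Subtype.val hab)
      · rintro ⟨x, hx⟩
        obtain ⟨i, -, rfl⟩ := Finset.mem_image.1 hx
        exact ⟨i, rfl⟩)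
  rw [← Matrix.det_submatrix_equiv_self e] at h
  exact h

/-- An N-matrix `A` of the second category of size `n + 1 ≥ 2`, partitioned as
`A = [[A', u], [vᵀ, a]]`, has: `A'` an N-matrix of the second category, `a < 0`,
`u, v < 0`, and the Schur complement `A' - (1/a)·u·vᵀ` a P-matrix. -/
theorem stmt_3 {n : ℕ} (hn : 1 ≤ n) (A : Matrix (Fin (n + 1)) (Fin (n + 1)) ℝ)
    (hA : IsNMatrix A) (hAneg : ∀ i j, A i j < 0) :
    IsNMatrix (Matrix.of fun i j : Fin n => A i.castSucc j.castSucc) ∧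
    (∀ i j : Fin n, A i.castSucc j.castSucc < 0) ∧
    A (Fin.last n) (Fin.last n) < 0 ∧
    (∀ i : Fin n, A i.castSucc (Fin.last n) < 0) ∧
    (∀ j : Fin n, A (Fin.last n) j.castSucc < 0) ∧
    IsPMatrix (Matrix.of fun i j : Fin n =>
      A i.castSucc j.castSucc -
        (1 / A (Fin.last n) (Fin.last n)) *
          (A i.castSucc (Fin.last n) * A (Fin.last n) j.castSucc)) := by
  have ha := hAneg (Fin.last n) (Fin.last n)
  refine ⟨?_, fun i j => hAneg _ _, ha, fun i => hAneg _ _, fun j => hAneg _ _, ?_⟩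
  · intro α hα
    haveI : Nonempty α := hα.to_subtype
    exact hA.det_submatrix_neg (fun i : α => (i : Fin n).castSucc)
      (fun a b hab => Subtype.ext (Fin.castSucc_injective n hab))
  · intro α hα
    let f : α ⊕ Unit → Fin (n + 1) := Sum.elim (fun i => (i : Fin n).castSucc) (fun _ => Fin.last n)
    have hf : Function.Injective f := by
      rintro (a | a) (b | b) hab
      · exact congrArg Sum.inl (Subtype.ext (Fin.castSucc_injective n hab))
      · exact absurd hab (Fin.castSucc_lt_last _).ne
      · exact absurd hab (Fin.castSucc_lt_last _).ne'
      · rfl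
    have h := hA.det_submatrix_neg f hf
    have hD : (Matrix.of fun _ _ : Unit => A (Fin.last n) (Fin.last n)) *
        (Matrix.of fun _ _ : Unit => (A (Fin.last n) (Fin.last n))⁻¹) = 1 := by
      ext i j
      simp [Matrix.mul_apply, ha.ne]
    letI : Invertible (A.submatrix f f).toBlocks₂₂ :=
      ⟨Matrix.of fun _ _ : Unit => (A (Fin.last n) (Fin.last n))⁻¹,
        _root_.mul_eq_one_comm.1 hD, hD⟩
    have hinv : ⅟(A.submatrix f f).toBlocks₂₂ =
      Matrix.of fun _ _ : Unit => (A (Fin.last n) (Fin.last n))⁻¹ := rfl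
    rw [← Matrix.fromBlocks_toBlocks (A.submatrix f f), Matrix.det_fromBlocks₂₂, hinv] at h
    have h1 : (A.submatrix f f).toBlocks₂₂.det = A (Fin.last n) (Fin.last n) := by
      simp [Matrix.toBlocks₂₂, f]
    rw [h1] at h
    have h2 := pos_of_mul_neg_right h ha.le
    refine lt_of_lt_of_eq h2 (congrArg Matrix.det ?_)
    ext i j
    simp [Matrix.mul_apply, Matrix.toBlocks₁₁, Matrix.toBlocks₁₂, Matrix.toBlocks₂₁, f]
    ring
end

section
/- Let A be a real n×n N-matrix of the first category (some entry of A is positive). Then there exists a permutation matrix P such that P·A·Pᵀ = [[A₁₁, A₁₂],[A₂₁, A₂₂]], where A₁₁ and A₂₂ are square matrices with all entries negative, and A₁₂ and A₂₁ have all entries positive. -/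
open Matrix

theorem nmat_sub {m : Type*} [Fintype m] [DecidableEq m] (A : Matrix m m ℝ)
    (hA : IsNMatrix A) {r : ℕ} (f : Fin (r + 1) → m) (hf : Function.Injective f) :
    (A.submatrix f f).det < 0 := by
  have h := hA (Finset.univ.map ⟨f, hf⟩) (by simp)
  let g : Fin (r + 1) → (Finset.univ.map ⟨f, hf⟩ : Finset m) := fun i => ⟨f i, by simp⟩
  have hg : Function.Bijective g := by
    constructor
    · intro a b hab
      exact hf (congrArg Subtype.val hab)
    · rintro ⟨x, hx⟩
      simp only [Finset.mem_map, Finset.mem_univ, true_and] at hx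
      obtain ⟨a, rfl⟩ := hx
      exact ⟨a, rfl⟩
  rw [← Matrix.det_submatrix_equiv_self (Equiv.ofBijective g hg)] at h
  exact h

theorem nmat_diag {m : Type*} [Fintype m] [DecidableEq m] (A : Matrix m m ℝ)
    (hA : IsNMatrix A) (i : m) : A i i < 0 := by
  have h := nmat_sub A hA (r := 0) ![i] (fun a b _ => by omega)
  rw [Matrix.det_fin_one] at h
  simpa using h

theorem nmat_two {m : Type*} [Fintype m] [DecidableEq m] (A : Matrix m m ℝ)
    (hA : IsNMatrix A) {i j : m} (hij : i ≠ j) : A i i * A j j < A i j * A j i := by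
  have h := nmat_sub A hA (r := 1) ![i, j] (by
    intro a b hab
    fin_cases a <;> fin_cases b <;> simp_all)
  rw [Matrix.det_fin_two] at h
  simp at h
  linarith

theorem nmat_pair {m : Type*} [Fintype m] [DecidableEq m] (A : Matrix m m ℝ)
    (hA : IsNMatrix A) (i j : m) : 0 < A i j * A j i := by
  by_cases hij : i = j
  · subst hij
    exact mul_pos_of_neg_of_neg (nmat_diag A hA i) (nmat_diag A hA i)
  · exact (mul_pos_of_neg_of_neg (nmat_diag A hA i) (nmat_diag A hA j)).trans
      (nmat_two A hA hij)

theorem nmat_triple {m : Type*} [Fintype m] [DecidableEq m] (A : Matrix m m ℝ)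
    (hA : IsNMatrix A) (i j k : m) : A i j * A j k * A k i < 0 := by
  by_cases hij : i = j
  · subst hij
    have := mul_neg_of_neg_of_pos (nmat_diag A hA i) (nmat_pair A hA i k)
    linarith
  by_cases hjk : j = k
  · subst hjk
    have := mul_neg_of_neg_of_pos (nmat_diag A hA j) (nmat_pair A hA i j)
    linarith
  by_cases hik : i = k
  · subst hik
    have := mul_neg_of_neg_of_pos (nmat_diag A hA i) (nmat_pair A hA i j)
    linarith
  by_contra hcon
  push Not at hcon
  have h := nmat_sub A hA (r := 2) ![i, j, k] (by
    intro a b hab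
    fin_cases a <;> fin_cases b <;> simp_all)
  rw [Matrix.det_fin_three] at h
  simp at h
  have p1 := nmat_pair A hA i j
  have p2 := nmat_pair A hA j k
  have p3 := nmat_pair A hA k i
  have hprod : 0 < (A i j * A j k * A k i) * (A i k * A k j * A j i) := by
    have := mul_pos (mul_pos p1 p2) p3
    linarith
  have hT : 0 < A i k * A k j * A j i := by
    by_contra hT
    push Not at hT
    have := mul_nonpos_of_nonneg_of_nonpos hcon hT
    linarith
  have di := nmat_diag A hA i
  have q1 := mul_lt_mul_of_neg_left (nmat_two A hA hjk) di
  have q2 := mul_neg_of_neg_of_pos (nmat_diag A hA j) p3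
  have q3 := mul_neg_of_neg_of_pos (nmat_diag A hA k) p1
  linarith

/-- Theorem 4.3: every N-matrix of the first category is permutation-similar to a
2×2 block matrix with negative diagonal blocks and positive off-diagonal blocks. -/
theorem stmt_4 {n : ℕ} (A : Matrix (Fin n) (Fin n) ℝ)
    (hA : IsNMatrix A) (hpos : ∃ i j, 0 < A i j) :
    ∃ (σ : Equiv.Perm (Fin n)) (k : ℕ), 0 < k ∧ k < n ∧
      ∀ i j : Fin n,
        (((i : ℕ) < k → (j : ℕ) < k →
          (σ.permMatrix ℝ * A * (σ.permMatrix ℝ)ᵀ) i j < 0) ∧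
        ((i : ℕ) < k → k ≤ (j : ℕ) →
          0 < (σ.permMatrix ℝ * A * (σ.permMatrix ℝ)ᵀ) i j) ∧
        (k ≤ (i : ℕ) → (j : ℕ) < k →
          0 < (σ.permMatrix ℝ * A * (σ.permMatrix ℝ)ᵀ) i j) ∧
        (k ≤ (i : ℕ) → k ≤ (j : ℕ) →
          (σ.permMatrix ℝ * A * (σ.permMatrix ℝ)ᵀ) i j < 0)) := by
  obtain ⟨i0, j0, h0⟩ := hpos
  let S : Finset (Fin n) := Finset.univ.filter (fun i => A i0 i < 0)
  have hkn : S.card < n := by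
    have : S.card < (Finset.univ : Finset (Fin n)).card := by
      apply Finset.card_lt_card
      rw [Finset.ssubset_univ_iff]
      intro h
      have : j0 ∈ S := h ▸ Finset.mem_univ _
      simp [S] at this
      linarith
    simpa using this
  have hk0 : 0 < S.card := Finset.card_pos.mpr ⟨i0, by simpa [S] using nmat_diag A hA i0⟩
  have hcard : Fintype.card {i : Fin n // (i : ℕ) < S.card} = Fintype.card {i // i ∈ S} := by
    rw [Fintype.card_coe, Fintype.card_subtype]
    rw [Fin.card_filter_val_lt]
    omega
  let e := Fintype.equivOfCardEq hcard
  let σ : Equiv.Perm (Fin n) := e.extendSubtype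
  have h1 : ∀ i : Fin n, (i : ℕ) < S.card → A i0 (σ i) < 0 := by
    intro i hi
    have := e.extendSubtype_mem i hi
    simpa [S] using this
  have h2 : ∀ i : Fin n, S.card ≤ (i : ℕ) → 0 < A i0 (σ i) := by
    intro i hi
    have := e.extendSubtype_not_mem i (by omega)
    have h3 : 0 ≤ A i0 (σ i) := by simpa [S] using this
    have h4 := nmat_pair A hA i0 (σ i)
    rcases h3.eq_or_lt with h5 | h5
    · rw [← h5] at h4; simp at h4
    · exact h5
  have key : ∀ i j, A i0 i * A i0 j * A i j < 0 := by
    intro i j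
    have t := nmat_triple A hA i0 i j
    have p := nmat_pair A hA i0 j
    by_contra hc
    push Not at hc
    have e1 := mul_neg_of_neg_of_pos t p
    have e2 := mul_nonneg hc (mul_self_nonneg (A i0 j))
    have e3 : (A i0 i * A i0 j * A i j) * (A i0 j * A j i0) < 0 := by
      have hsq : 0 < A i0 j * A i0 j := by
        apply mul_self_pos.mpr
        intro h; rw [h] at p; simp at p
      have := mul_neg_of_neg_of_pos t hsq
      linarith
    have e4 := mul_nonneg hc p.le
    linarith
  have hent : ∀ i j, (σ.permMatrix ℝ * A * (σ.permMatrix ℝ)ᵀ) i j = A (σ i) (σ j) := by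
    intro i j
    simp [Equiv.Perm.permMatrix, PEquiv.toMatrix_toPEquiv_mul, Matrix.mul_apply,
      PEquiv.toMatrix_apply, Equiv.symm_apply_eq]
  refine ⟨σ, S.card, hk0, hkn, fun i j => ?_⟩
  rw [hent]
  have kk := key (σ i) (σ j)
  refine ⟨fun a b => ?_, fun a b => ?_, fun a b => ?_, fun a b => ?_⟩
  · exact neg_of_mul_neg_right kk (mul_pos_of_neg_of_neg (h1 i a) (h1 j b)).le
  · exact pos_of_mul_neg_right kk (mul_neg_of_neg_of_pos (h1 i a) (h2 j b)).le
  · exact pos_of_mul_neg_right kk (mul_neg_of_pos_of_neg (h2 i a) (h1 j b)).le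
  · exact neg_of_mul_neg_right kk (mul_pos (h2 i a) (h2 j b)).le
end

section
/- Let A be a real n×n matrix and let α ⊆ {1,…,n} with |α| = 1, say α = {i}. Then A is a P-matrix if and only if the 1×1 matrix A[α] is a P-matrix (i.e., a_{ii} > 0), the principal submatrix A[ᾱ] is a P-matrix, and the Schur complement A/A[α] = A[ᾱ] − A[ᾱ,α] A[α]⁻¹ A[α,ᾱ] is a P-matrix. -/
open Matrix

theorem IsPMatrix.det_inj {m : Type*} [Fintype m] [DecidableEq m] {A : Matrix m m ℝ}
    (h : IsPMatrix A) {ι : Type*} [Fintype ι] [DecidableEq ι] (f : ι → m)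
    (hf : Function.Injective f) : 0 < (A.submatrix f f).det := by
  cases isEmpty_or_nonempty ι with
  | inl _ => simp
  | inr _ =>
    have h1 := h (Finset.univ.image f) (Finset.univ_nonempty.image f)
    let e : ι ≃ (Finset.univ.image f : Finset m) :=
      Equiv.ofBijective (fun x => ⟨f x, Finset.mem_image_of_mem f (Finset.mem_univ x)⟩) (by
        constructor
        · intro x y hxy
          exact hf (congrArg Subtype.val hxy)
        · rintro ⟨y, hy⟩
          obtain ⟨x, -, rfl⟩ := Finset.mem_image.1 hy
          exact ⟨x, rfl⟩)
    rw [← Matrix.det_submatrix_equiv_self e] at h1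
    exact h1

theorem schur_det_aux {m ι : Type*} [Fintype ι] [DecidableEq ι] (A : Matrix m m ℝ) (i : m)
    (hi : A i i ≠ 0) (f : ι → m) :
    (A.submatrix (Sum.elim (fun _ : Unit => i) f) (Sum.elim (fun _ : Unit => i) f)).det =
      A i i * (Matrix.of fun j k : ι =>
        A (f j) (f k) - A (f j) i * (A i i)⁻¹ * A i (f k)).det := by
  let D : Matrix Unit Unit ℝ := Matrix.of fun _ _ => A i i
  let D' : Matrix Unit Unit ℝ := Matrix.of fun _ _ => (A i i)⁻¹
  let _ : Invertible D := ⟨D', by ext; simp [D, D', Matrix.mul_apply, hi],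
    by ext; simp [D, D', Matrix.mul_apply, hi]⟩
  have h : A.submatrix (Sum.elim (fun _ : Unit => i) f) (Sum.elim (fun _ : Unit => i) f) =
      Matrix.fromBlocks D (Matrix.of fun _ k => A i (f k)) (Matrix.of fun j _ => A (f j) i)
        (Matrix.of fun j k => A (f j) (f k)) := by
    ext (a | a) (b | b) <;> rfl
  have hD : ⅟D = D' := rfl
  rw [h, Matrix.det_fromBlocks₁₁, hD]
  congr 1
  · simp [D]
  · congr 1
    ext j k
    simp [D', Matrix.mul_apply]

/-- Theorem 3.1: for `α = {i}`, `A` is a P-matrix iff `A[α]` and `A[ᾱ]` are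
P-matrices and the Schur complement `A/A[α]` is a P-matrix. -/
theorem stmt_5 {n : ℕ} (A : Matrix (Fin n) (Fin n) ℝ) (i : Fin n) :
    IsPMatrix A ↔
      0 < A i i ∧
      IsPMatrix (A.submatrix (fun j : {j : Fin n // j ≠ i} => (j : Fin n))
        (fun j : {j : Fin n // j ≠ i} => (j : Fin n))) ∧
      IsPMatrix (Matrix.of fun j k : {j : Fin n // j ≠ i} =>
        A (j : Fin n) (k : Fin n) - A (j : Fin n) i * (A i i)⁻¹ * A i (k : Fin n)) := by
  constructor
  · intro h
    have hi : 0 < A i i := by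
      have := h.det_inj (fun _ : Unit => i) (fun _ _ _ => rfl)
      simpa using this
    refine ⟨hi, ?_, ?_⟩
    · intro α _
      exact h.det_inj (fun j : α => ((j : {j : Fin n // j ≠ i}) : Fin n))
        (fun x y hxy => Subtype.ext (Subtype.ext hxy))
    · intro α _
      have h1 := h.det_inj (Sum.elim (fun _ : Unit => i)
        (fun j : α => ((j : {j : Fin n // j ≠ i}) : Fin n))) (by
          rintro (x | x) (y | y) hxy
          · rfl
          · exact absurd hxy.symm y.1.2
          · exact absurd hxy x.1.2
          · exact congrArg Sum.inr (Subtype.ext (Subtype.ext hxy)))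
      rw [schur_det_aux A i hi.ne'] at h1
      exact pos_of_mul_pos_right h1 hi.le
  · rintro ⟨hi, h1, h2⟩ α _
    by_cases hα : i ∈ α
    · let g : {j : α // (j : Fin n) ≠ i} → α := fun j => j.1
      let e : Unit ⊕ {j : α // (j : Fin n) ≠ i} ≃ α :=
        Equiv.ofBijective (Sum.elim (fun _ => ⟨i, hα⟩) g) (by
          constructor
          · rintro (x | x) (y | y) hxy
            · rfl
            · exact absurd (congrArg Subtype.val hxy).symm y.2
            · exact absurd (congrArg Subtype.val hxy) x.2
            · exact congrArg Sum.inr (Subtype.ext hxy)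
          · intro y
            by_cases hy : (y : Fin n) = i
            · exact ⟨Sum.inl (), Subtype.ext hy.symm⟩
            · exact ⟨Sum.inr ⟨y, hy⟩, rfl⟩)
      rw [← Matrix.det_submatrix_equiv_self e]
      have h3 := h2.det_inj (fun j : {j : α // (j : Fin n) ≠ i} =>
        (⟨(j.1 : Fin n), j.2⟩ : {j : Fin n // j ≠ i})) (by
          intro x y hxy
          exact Subtype.ext (Subtype.ext (Subtype.mk.inj hxy)))
      have h4 := mul_pos hi h3
      have h5 := schur_det_aux A i hi.ne' (fun j : {j : α // (j : Fin n) ≠ i} => (j.1 : Fin n))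
      have h6 : ((A.submatrix (fun i : α => (i : Fin n)) (fun j : α => (j : Fin n))).submatrix
          e e) = A.submatrix (Sum.elim (fun _ : Unit => i)
            (fun j : {j : α // (j : Fin n) ≠ i} => (j.1 : Fin n))) (Sum.elim (fun _ : Unit => i)
            (fun j : {j : α // (j : Fin n) ≠ i} => (j.1 : Fin n))) := by
        ext (a | a) (b | b) <;> rfl
      rw [h6, h5]
      exact h4
    · exact h1.det_inj (fun j : α => (⟨j, fun h => hα (h ▸ j.2)⟩ : {j : Fin n // j ≠ i}))
        (fun x y hxy => Subtype.ext (Subtype.mk.inj hxy))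
end

section
/- A real n×n matrix A is an N-matrix if and only if A is invertible and A⁻¹ is an almost P-matrix. -/
open Matrix

/-- A real matrix is an almost P-matrix if every proper principal minor is
positive and its determinant is negative. -/
def IsAlmostPMatrix {m : Type*} [Fintype m] [DecidableEq m] (B : Matrix m m ℝ) : Prop :=
  (∀ α : Finset m, α.Nonempty → α ≠ Finset.univ →
    0 < (B.submatrix (fun i : α => (i : m)) (fun j : α => (j : m))).det) ∧
  B.det < 0

theorem jacobi_aux {m k n : Type*} [Fintype m] [DecidableEq m] [Fintype k] [DecidableEq k]
    [Fintype n] [DecidableEq n] (e : m ⊕ k ≃ n) (A B : Matrix n n ℝ) (h : A * B = 1) :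
    A.det * (B.submatrix (fun i => e (Sum.inr i)) (fun i => e (Sum.inr i))).det =
      (A.submatrix (fun i => e (Sum.inl i)) (fun i => e (Sum.inl i))).det := by
  have hAB : A.submatrix e e * B.submatrix e e = 1 := by
    rw [Matrix.submatrix_mul_equiv, h, Matrix.submatrix_one_equiv]
  have hA := (Matrix.fromBlocks_toBlocks (A.submatrix e e)).symm
  have hB := (Matrix.fromBlocks_toBlocks (B.submatrix e e)).symm
  rw [hA, hB, Matrix.fromBlocks_multiply, ← Matrix.fromBlocks_one, Matrix.fromBlocks_inj] at hAB
  obtain ⟨-, h12, -, h22⟩ := hAB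
  have key : A.submatrix e e * Matrix.fromBlocks 1 (B.submatrix e e).toBlocks₁₂ 0
      (B.submatrix e e).toBlocks₂₂ =
      Matrix.fromBlocks (A.submatrix e e).toBlocks₁₁ 0 (A.submatrix e e).toBlocks₂₁ 1 := by
    conv_lhs => rw [hA]
    rw [Matrix.fromBlocks_multiply, h12, h22]
    simp
  have hd := congrArg Matrix.det key
  rw [Matrix.det_mul, Matrix.det_fromBlocks_zero₂₁, Matrix.det_fromBlocks_zero₁₂,
    Matrix.det_submatrix_equiv_self, Matrix.det_one, Matrix.det_one, one_mul, mul_one] at hd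
  exact hd

theorem jacobi_finset {n : Type*} [Fintype n] [DecidableEq n] (A B : Matrix n n ℝ)
    (h : A * B = 1) (α β : Finset n) (hβ : ∀ x, x ∈ β ↔ ¬ x ∈ α) :
    A.det * (B.submatrix (fun i : β => (i : n)) (fun i : β => (i : n))).det =
      (A.submatrix (fun i : α => (i : n)) (fun i : α => (i : n))).det :=
  jacobi_aux ((Equiv.sumCongr (Equiv.refl _) (Equiv.subtypeEquivRight hβ)).trans
    (Equiv.sumCompl (fun x => x ∈ α))) A B h

theorem det_univ_aux {n : Type*} [Fintype n] [DecidableEq n] (A : Matrix n n ℝ) :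
    (A.submatrix (fun i : (Finset.univ : Finset n) => (i : n))
      (fun i : (Finset.univ : Finset n) => (i : n))).det = A.det := by
  have e : ∃ e : (Finset.univ : Finset n) ≃ n, ∀ i, e i = (i : n) :=
    ⟨Equiv.subtypeUnivEquiv (fun x => Finset.mem_univ x), fun _ => rfl⟩
  obtain ⟨e, he⟩ := e
  have hf : (fun i : (Finset.univ : Finset n) => (i : n)) = e := funext fun i => (he i).symm
  rw [hf]
  exact Matrix.det_submatrix_equiv_self e A

/-- [N1]: `A` is an N-matrix iff `A` is invertible and `A⁻¹` is an almost P-matrix. -/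
theorem stmt_6 {n : ℕ} (hn : 0 < n) (A : Matrix (Fin n) (Fin n) ℝ) :
    IsNMatrix A ↔ IsUnit A.det ∧ IsAlmostPMatrix A⁻¹ := by
  have : Nonempty (Fin n) := ⟨⟨0, hn⟩⟩
  constructor
  · intro hA
    have hd : A.det < 0 := by
      rw [← det_univ_aux]
      exact hA _ Finset.univ_nonempty
    have hu : IsUnit A.det := isUnit_iff_ne_zero.mpr hd.ne
    have hm : A * A⁻¹ = 1 := Matrix.mul_nonsing_inv A hu
    refine ⟨hu, fun α hα hα' => ?_, ?_⟩
    · have hj := jacobi_finset A A⁻¹ hm αᶜ α (by simp)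
      have hn' := hA αᶜ (by
        rw [Finset.nonempty_iff_ne_empty]
        simpa [Finset.compl_eq_empty_iff] using hα')
      rw [← hj] at hn'
      exact pos_of_mul_neg_right hn' hd.le
    · have := congrArg Matrix.det hm
      rw [Matrix.det_mul, Matrix.det_one] at this
      by_contra hc
      nlinarith
  · rintro ⟨hu, hP, hd⟩ α hα
    have hm : A * A⁻¹ = 1 := Matrix.mul_nonsing_inv A hu
    have hA : A.det < 0 := by
      have := congrArg Matrix.det hm
      rw [Matrix.det_mul, Matrix.det_one] at this
      by_contra hc
      nlinarith
    by_cases hα' : α = Finset.univ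
    · subst hα'
      rw [det_univ_aux]
      exact hA
    · have hj := jacobi_finset A A⁻¹ hm α αᶜ (by simp)
      rw [← hj]
      refine mul_neg_of_neg_of_pos hA (hP _ ?_ ?_)
      · rw [Finset.nonempty_iff_ne_empty]
        simpa [Finset.compl_eq_empty_iff] using hα'
      · simpa [Finset.compl_eq_univ_iff] using hα.ne_empty
end

section
/- Let A be a real n×n matrix with all entries negative. Then A is an N-matrix if and only if A does not reverse the sign of any nonzero vector that is not unisigned; that is, if and only if for every nonzero x ∈ ℝⁿ satisfying (Ax)ᵢ · xᵢ ≤ 0 for all i ∈ {1,…,n}, either x ≥ 0 or x ≤ 0 entrywise. -/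
open Matrix

/-- N-matrices via injective index maps. -/
def NInj {n : ℕ} (A : Matrix (Fin n) (Fin n) ℝ) : Prop :=
  ∀ (k : ℕ) (f : Fin (k+1) → Fin n), Function.Injective f → (A.submatrix f f).det < 0

/-- Sign reversal only of unisigned vectors. -/
def RevUni {n : ℕ} (A : Matrix (Fin n) (Fin n) ℝ) : Prop :=
  ∀ x : Fin n → ℝ, x ≠ 0 → (∀ i, A.mulVec x i * x i ≤ 0) →
        (∀ i, 0 ≤ x i) ∨ (∀ i, x i ≤ 0)

/-- Diagonal nonpositive, larger principal minors negative. -/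
def WeakN {n : ℕ} (A : Matrix (Fin n) (Fin n) ℝ) : Prop :=
  (∀ i, A i i ≤ 0) ∧
  ∀ (k : ℕ) (f : Fin (k+2) → Fin n), Function.Injective f → (A.submatrix f f).det < 0

lemma isN_iff {n : ℕ} (A : Matrix (Fin n) (Fin n) ℝ) : IsNMatrix A ↔ NInj A := by
  constructor
  · intro h k f hf
    have h1 := h (Finset.univ.map ⟨f, hf⟩) (by simp)
    let e : Fin (k+1) ≃ (Finset.univ.map ⟨f, hf⟩ : Finset (Fin n)) :=
      Equiv.ofBijective (fun i => ⟨f i, by simp⟩) (by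
        constructor
        · intro a b hab
          exact hf (by simpa using hab)
        · rintro ⟨y, hy⟩
          simp at hy
          obtain ⟨a, ha⟩ := hy
          exact ⟨a, by simp [ha]⟩)
    rw [← Matrix.det_submatrix_equiv_self e] at h1
    exact h1
  · intro h α hα
    obtain ⟨k, hk⟩ : ∃ k, α.card = k + 1 :=
      ⟨α.card - 1, by have := hα.card_pos; omega⟩
    let e : Fin (k+1) ≃ α := (α.equivFinOfCardEq hk).symm
    rw [← Matrix.det_submatrix_equiv_self e]
    exact h k (fun i => (e i : Fin n)) (fun a b hab => e.injective (Subtype.ext hab))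

lemma mulVec_restrict {n k : ℕ} (A : Matrix (Fin n) (Fin n) ℝ) (f : Fin k → Fin n)
    (hf : Function.Injective f) (x : Fin n → ℝ) (hx : ∀ j, j ∉ Set.range f → x j = 0) (i : Fin k) :
    (A.submatrix f f).mulVec (x ∘ f) i = A.mulVec x (f i) := by
  simp only [Matrix.mulVec, dotProduct]
  apply Fintype.sum_of_injective f hf
  · intro j hj
    simp [hx j hj]
  · intro j
    simp

lemma RevUni.sub {n k : ℕ} {A : Matrix (Fin n) (Fin n) ℝ} (h : RevUni A) (f : Fin k → Fin n)
    (hf : Function.Injective f) : RevUni (A.submatrix f f) := by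
  intro y hy hr
  have hc : Function.extend f y 0 ∘ f = y := by
    funext i
    simp [hf.extend_apply]
  have hz : ∀ j, j ∉ Set.range f → Function.extend f y 0 j = 0 := by
    intro j hj
    rw [Function.extend_apply']
    · rfl
    · exact hj
  have hci : ∀ i, Function.extend f y 0 (f i) = y i := fun i => hf.extend_apply y 0 i
  have := h (Function.extend f y 0) (by
    intro h0
    apply hy
    rw [← hc, h0]
    rfl) (by
    intro j
    by_cases hj : j ∈ Set.range f
    · obtain ⟨i, rfl⟩ := hj
      rw [← mulVec_restrict A f hf _ hz, hc, hci]
      exact hr i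
    · simp [hz j hj])
  rcases this with h1 | h1
  · left; intro i; simpa [hci] using h1 (f i)
  · right; intro i; simpa [hci] using h1 (f i)

lemma det_add_single {n : ℕ} (M : Matrix (Fin (n+1)) (Fin (n+1)) ℝ) (p : Fin (n+1)) (d : ℝ) :
    (M + Matrix.single p p d).det = M.det + d * (M.submatrix p.succAbove p.succAbove).det := by
  rw [Matrix.det_succ_row _ p, Matrix.det_succ_row M p]
  have h1 : ∀ j : Fin (n+1), (M + Matrix.single p p d).submatrix p.succAbove j.succAbove
      = M.submatrix p.succAbove j.succAbove := by
    intro j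
    ext a b
    simp [Matrix.single_apply, (Fin.succAbove_ne p a).symm]
  simp only [h1, Matrix.add_apply]
  have h2 : ∀ j : Fin (n+1), (-1 : ℝ) ^ ((p : ℕ) + (j : ℕ)) * (M p j + Matrix.single p p d p j) *
      (M.submatrix p.succAbove j.succAbove).det =
      (-1 : ℝ) ^ ((p : ℕ) + (j : ℕ)) * M p j * (M.submatrix p.succAbove j.succAbove).det +
      (if p = j then d * (M.submatrix p.succAbove p.succAbove).det else 0) := by
    intro j
    by_cases hj : p = j
    · subst hj
      simp only [Matrix.single_apply_same, if_true]
      rw [Even.neg_one_pow ⟨(p : ℕ), rfl⟩]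
      ring
    · simp [Matrix.single_apply, hj]
  simp only [h2, Finset.sum_add_distrib]
  simp

lemma submatrix_add_single {n k : ℕ} (A : Matrix (Fin n) (Fin n) ℝ) (f : Fin k → Fin n)
    (hf : Function.Injective f) (p : Fin k) (d : ℝ) :
    (A + Matrix.single (f p) (f p) d).submatrix f f = A.submatrix f f + Matrix.single p p d := by
  ext a b
  simp [Matrix.single_apply, hf.eq_iff]

lemma WeakN.add {n : ℕ} {A : Matrix (Fin n) (Fin n) ℝ} (h : WeakN A) (i : Fin n) (d : ℝ)
    (hd : 0 ≤ d) (hi : A i i + d ≤ 0) : WeakN (A + Matrix.single i i d) := by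
  refine ⟨fun j => ?_, fun k f hf => ?_⟩
  · by_cases hj : i = j
    · subst hj; simpa using hi
    · simpa [Matrix.single_apply, hj] using h.1 j
  · by_cases hr : i ∈ Set.range f
    · obtain ⟨p, rfl⟩ := hr
      rw [submatrix_add_single A f hf, det_add_single]
      have h1 := h.2 k f hf
      have h2 : ((A.submatrix f f).submatrix p.succAbove p.succAbove).det ≤ 0 := by
        rw [Matrix.submatrix_submatrix]
        have hg : Function.Injective (f ∘ p.succAbove) := hf.comp Fin.succAbove_right_injective
        cases k with
        | zero => rw [Matrix.det_fin_one]; exact h.1 _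
        | succ k => exact (h.2 k _ hg).le
      nlinarith
    · have : (A + Matrix.single i i d).submatrix f f = A.submatrix f f := by
        ext a b
        have : i ≠ f a := fun h => hr ⟨a, h.symm⟩
        simp [Matrix.single_apply, this]
      rw [this]
      exact h.2 k f hf

lemma weak_diag {n : ℕ} {A : Matrix (Fin n) (Fin n) ℝ} (h : WeakN A) (D : Fin n → ℝ)
    (hD : ∀ i, 0 ≤ D i) (hi : ∀ i, A i i + D i ≤ 0) : WeakN (A + Matrix.diagonal D) := by
  have key : ∀ T : Finset (Fin n),
      WeakN (A + Matrix.diagonal (fun i => if i ∈ T then D i else 0)) := by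
    intro T
    induction T using Finset.induction_on with
    | empty => simpa using h
    | insert a T ha ih =>
      have := ih.add a (D a) (hD a) (by simpa [ha] using hi a)
      convert this using 1
      rw [add_assoc]
      congr 1
      ext i j
      by_cases hij : i = j
      · subst hij
        by_cases hia : i = a
        · subst hia; simp [ha]
        · simp [hia, Matrix.single_apply, Ne.symm hia]
      · simp only [Matrix.diagonal_apply, hij, Matrix.add_apply, Matrix.single_apply]
        have : ¬ (a = i ∧ a = j) := fun h => hij (h.1.symm.trans h.2)
        simp [this]
  simpa using key Finset.univ

lemma det_schur {k : ℕ} (M : Matrix (Fin (k+1)) (Fin (k+1)) ℝ) (h0 : M 0 0 ≠ 0) :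
    M.det = M 0 0 * (Matrix.of fun i j : Fin k =>
      M i.succ j.succ - M i.succ 0 * M 0 j.succ / M 0 0).det := by
  let B : Matrix (Fin (k+1)) (Fin (k+1)) ℝ := Matrix.of fun i j =>
    Fin.cases (M 0 j) (fun i' => M i'.succ j - M i'.succ 0 / M 0 0 * M 0 j) i
  have hB : M.det = B.det := by
    apply Matrix.det_eq_of_forall_row_eq_smul_add_const
      (fun i => Fin.cases 0 (fun i' => M i'.succ 0 / M 0 0) i) 0 (by simp)
    intro i j
    refine Fin.cases ?_ (fun i' => ?_) i
    · simp [B]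
    · simp [B]
  rw [hB, Matrix.det_succ_column_zero, Fin.sum_univ_succ]
  have hz : ∀ i : Fin k, B i.succ 0 = 0 := by
    intro i
    simp [B, h0]
  simp only [hz]
  simp only [mul_zero, zero_mul, Finset.sum_const_zero, add_zero]
  have : B.submatrix (Fin.succAbove 0) Fin.succ = Matrix.of fun i j : Fin k =>
      M i.succ j.succ - M i.succ 0 * M 0 j.succ / M 0 0 := by
    ext i j
    simp [B]
    ring
  rw [this]
  simp [B]

lemma fwd : ∀ (n : ℕ) (A : Matrix (Fin n) (Fin n) ℝ), (∀ i j, A i j < 0) → NInj A → RevUni A := by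
  intro n
  induction n with
  | zero => intro A _ _ x _ _; left; intro i; exact i.elim0
  | succ m ih =>
    intro A hneg hN x hx hr
    by_cases hz : ∃ i, x i = 0
    · obtain ⟨i, hi⟩ := hz
      have hinj : Function.Injective i.succAbove := Fin.succAbove_right_injective
      have hzero : ∀ j, j ∉ Set.range i.succAbove → x j = 0 := by
        intro j hj
        rw [Fin.range_succAbove] at hj
        simp at hj
        rw [hj, hi]
      have h1 := ih (A.submatrix i.succAbove i.succAbove) (fun _ _ => hneg _ _)
        (fun k f hf => hN k (i.succAbove ∘ f) (hinj.comp hf)) (x ∘ i.succAbove)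
        (by
          intro h0
          apply hx
          funext j
          refine Fin.succAboveCases i hi (fun l => ?_) j
          exact congrFun h0 l)
        (by
          intro l
          rw [mulVec_restrict A _ hinj x hzero]
          exact hr _)
      rcases h1 with h1 | h1
      · left; intro j; exact Fin.succAboveCases i hi.ge (fun l => h1 l) j
      · right; intro j; exact Fin.succAboveCases i hi.le (fun l => h1 l) j
    · push Not at hz
      let D : Fin (m+1) → ℝ := fun i => -(A.mulVec x i) / x i
      have hDx : ∀ i, A.mulVec x i = - (D i * x i) := by
        intro i
        have := hz i
        simp only [D]
        field_simp
        try ring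
      have hD : ∀ i, 0 ≤ D i := by
        intro i
        have h1 := hr i
        rw [hDx i] at h1
        have h2 : 0 < x i * x i := mul_self_pos.mpr (hz i)
        by_contra hlt
        push Not at hlt
        nlinarith
      by_cases hall : ∀ i, A i i + D i ≤ 0
      · cases m with
        | zero =>
          rcases le_total 0 (x 0) with h | h
          · left; intro i; rwa [show i = 0 from Fin.ext (by omega)]
          · right; intro i; rwa [show i = 0 from Fin.ext (by omega)]
        | succ m =>
          exfalso
          have hW : WeakN A := ⟨fun i => (hneg i i).le, fun k f hf => hN (k+1) f hf⟩
          have h1 := (weak_diag hW D hD hall).2 m id Function.injective_id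
          rw [Matrix.submatrix_id_id] at h1
          apply h1.ne
          rw [← Matrix.exists_mulVec_eq_zero_iff]
          refine ⟨x, hx, ?_⟩
          funext i
          rw [Matrix.add_mulVec, Pi.add_apply, hDx i, Matrix.mulVec_diagonal]
          simp
      · push Not at hall
        obtain ⟨i, hi⟩ := hall
        have hinj : Function.Injective i.succAbove := Fin.succAbove_right_injective
        set c := A i i + D i with hc
        let S : Matrix (Fin m) (Fin m) ℝ := Matrix.of fun a b =>
          A (i.succAbove a) (i.succAbove b) - A (i.succAbove a) i * A i (i.succAbove b) / c
        have hSneg : ∀ a b, S a b < 0 := by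
          intro a b
          have h1 := hneg (i.succAbove a) (i.succAbove b)
          have h2 := mul_pos_of_neg_of_neg (hneg (i.succAbove a) i) (hneg i (i.succAbove b))
          have h3 := div_pos h2 hi
          simp only [S, Matrix.of_apply]
          linarith
        have hSN : NInj S := by
          intro k f hf
          let g : Fin (k+2) → Fin (m+1) := Fin.cons i (i.succAbove ∘ f)
          have hg0 : g 0 = i := rfl
          have hgs : ∀ a : Fin (k+1), g a.succ = i.succAbove (f a) := fun a => rfl
          have hg : Function.Injective g := by
            rw [Fin.cons_injective_iff]
            refine ⟨?_, hinj.comp hf⟩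
            rintro ⟨a, ha⟩
            exact Fin.succAbove_ne i _ ha
          have e1 := submatrix_add_single A g hg 0 (D i)
          have e2 := det_add_single (A.submatrix g g) 0 (D i)
          rw [← e1, Matrix.submatrix_submatrix] at e2
          have n1 := hN (k+1) g hg
          have n2 := hN k (g ∘ Fin.succAbove 0) (hg.comp Fin.succAbove_right_injective)
          have hM0 : ((A + Matrix.single (g 0) (g 0) (D i)).submatrix g g) 0 0 = c := by
            simp [hg0, hc]
          have e3 := det_schur ((A + Matrix.single (g 0) (g 0) (D i)).submatrix g g)
            (by rw [hM0]; exact hi.ne')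
          rw [hM0] at e3
          have e4 : (Matrix.of fun a b : Fin (k+1) =>
              ((A + Matrix.single (g 0) (g 0) (D i)).submatrix g g) a.succ b.succ -
              ((A + Matrix.single (g 0) (g 0) (D i)).submatrix g g) a.succ 0 *
              ((A + Matrix.single (g 0) (g 0) (D i)).submatrix g g) 0 b.succ / c)
              = S.submatrix f f := by
            ext a b
            simp [S, hg0, hgs, Matrix.single_apply, (Fin.succAbove_ne i _).symm]
          rw [e4, e2] at e3
          have hDi := hD i
          by_contra hge
          push Not at hge
          have := mul_nonneg hi.le hge
          nlinarith
        have hsum : ∀ j, A.mulVec x j = A j i * x i +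
            ∑ l, A j (i.succAbove l) * x (i.succAbove l) := by
          intro j
          simp only [Matrix.mulVec, dotProduct]
          rw [Fin.sum_univ_succAbove _ i]
        have hrow : ∑ l, A i (i.succAbove l) * x (i.succAbove l) = - (c * x i) := by
          have h1 := hsum i
          rw [hDx i] at h1
          rw [hc]; linarith
        have hS : ∀ a, S.mulVec (x ∘ i.succAbove) a = A.mulVec x (i.succAbove a) := by
          intro a
          have h1 : S.mulVec (x ∘ i.succAbove) a =
              ∑ l, A (i.succAbove a) (i.succAbove l) * x (i.succAbove l)
              - A (i.succAbove a) i / c * ∑ l, A i (i.succAbove l) * x (i.succAbove l) := by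
            simp only [Matrix.mulVec, dotProduct, S, Matrix.of_apply, Function.comp]
            rw [Finset.mul_sum, ← Finset.sum_sub_distrib]
            apply Finset.sum_congr rfl
            intro l _
            ring
          rw [h1, hrow, hsum]
          have := hi.ne'
          field_simp
          ring
        cases m with
        | zero =>
          rcases le_total 0 (x 0) with h | h
          · left; intro i; rwa [show i = 0 from Fin.ext (by omega)]
          · right; intro i; rwa [show i = 0 from Fin.ext (by omega)]
        | succ m =>
          have h1 := ih S hSneg hSN (x ∘ i.succAbove)
            (fun h0 => hz (i.succAbove 0) (congrFun h0 0))
            (fun a => by rw [hS a]; exact hr _)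
          rcases h1 with h1 | h1
          · left
            have hxi : 0 ≤ x i := by
              have : ∑ l, A i (i.succAbove l) * x (i.succAbove l) ≤ 0 :=
                Finset.sum_nonpos fun l _ => mul_nonpos_of_nonpos_of_nonneg (hneg _ _).le (h1 l)
              rw [hrow] at this
              exact nonneg_of_mul_nonneg_right (by linarith : 0 ≤ c * x i) hi
            intro j; exact Fin.succAboveCases i hxi (fun l => h1 l) j
          · right
            have hxi : x i ≤ 0 := by
              have : 0 ≤ ∑ l, A i (i.succAbove l) * x (i.succAbove l) :=
                Finset.sum_nonneg fun l _ => mul_nonneg_of_nonpos_of_nonpos (hneg _ _).le (h1 l)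
              rw [hrow] at this
              by_contra hcon
              push Not at hcon
              have := mul_pos hi hcon
              linarith
            intro j; exact Fin.succAboveCases i hxi (fun l => h1 l) j

lemma mulVec_neg_of_nonneg {n : ℕ} (A : Matrix (Fin n) (Fin n) ℝ) (hneg : ∀ i j, A i j < 0)
    (x : Fin n → ℝ) (hx : x ≠ 0) (h : ∀ i, 0 ≤ x i) (i : Fin n) : A.mulVec x i < 0 := by
  obtain ⟨j, hj⟩ := Function.ne_iff.mp hx
  have hj' : 0 < x j := lt_of_le_of_ne (h j) (Ne.symm hj)
  simp only [Matrix.mulVec, dotProduct]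
  exact Finset.sum_neg' (fun l _ => mul_nonpos_of_nonpos_of_nonneg (hneg i l).le (h l))
    ⟨j, Finset.mem_univ j, mul_neg_of_neg_of_pos (hneg i j) hj'⟩

lemma bwd : ∀ (k : ℕ) (A : Matrix (Fin (k+1)) (Fin (k+1)) ℝ), (∀ i j, A i j < 0) → RevUni A →
    A.det < 0 := by
  intro k
  induction k with
  | zero => intro A hneg _; rw [Matrix.det_fin_one]; exact hneg 0 0
  | succ k ih =>
    intro A hneg hR
    by_contra hdet
    push Not at hdet
    have hinj : Function.Injective (Fin.succAbove (0 : Fin (k+2))) := Fin.succAbove_right_injective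
    have h1 := ih (A.submatrix (Fin.succAbove 0) (Fin.succAbove 0)) (fun _ _ => hneg _ _)
      (hR.sub _ hinj)
    set d' := (A.submatrix (Fin.succAbove 0) (Fin.succAbove 0)).det with hd'
    let t := A.det / (-d')
    have ht : 0 ≤ t := div_nonneg hdet (by linarith)
    have h2 : (A + Matrix.single 0 0 t).det = 0 := by
      rw [det_add_single, ← hd']
      simp only [t]
      have := h1.ne
      field_simp
      ring
    obtain ⟨x, hx, hx0⟩ := Matrix.exists_mulVec_eq_zero_iff.mpr h2
    have hAx : ∀ i, A.mulVec x i = - (if i = 0 then t * x 0 else 0) := by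
      intro i
      have h3 := congrFun hx0 i
      rw [Matrix.add_mulVec, Pi.add_apply, Pi.zero_apply] at h3
      have h4 : (Matrix.single (0 : Fin (k+2)) 0 t).mulVec x i = if i = 0 then t * x 0 else 0 := by
        simp only [Matrix.mulVec, dotProduct, Matrix.single_apply]
        by_cases hi : i = 0
        · subst hi; simp
        · simp [hi, Ne.symm hi]
      rw [h4] at h3
      linarith
    have h1' : A.mulVec x 1 = 0 := by
      rw [hAx]; simp
    rcases hR x hx (by
      intro i
      rw [hAx]
      by_cases hi : i = 0
      · subst hi
        have := mul_nonneg ht (mul_self_nonneg (x 0))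
        simp only [if_true]
        nlinarith
      · simp [hi]) with h | h
    · exact (mulVec_neg_of_nonneg A hneg x hx h 1).ne h1'
    · have := mulVec_neg_of_nonneg A hneg (-x) (neg_ne_zero.mpr hx) (fun i => by simpa using h i) 1
      rw [Matrix.mulVec_neg, Pi.neg_apply, h1'] at this
      simp at this

/-- [N3]: a matrix with all entries negative is an N-matrix iff it does not
reverse the sign of any nonzero vector that is not unisigned. -/
theorem stmt_7 {n : ℕ} (A : Matrix (Fin n) (Fin n) ℝ) (hneg : ∀ i j, A i j < 0) :
    IsNMatrix A ↔
      ∀ x : Fin n → ℝ, x ≠ 0 → (∀ i, A.mulVec x i * x i ≤ 0) →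
        (∀ i, 0 ≤ x i) ∨ (∀ i, x i ≤ 0) := by
  rw [isN_iff]
  constructor
  · intro h
    exact fwd n A hneg h
  · intro h k f hf
    have hR : RevUni A := h
    exact bwd k _ (fun _ _ => hneg _ _) (hR.sub f hf)
end

section
/- Let A be a real n×n N-matrix. Then A has exactly one negative real eigenvalue, counted with algebraic multiplicity; that is, exactly one root (with multiplicity) of the characteristic polynomial of A lies in the open interval (−∞, 0). -/
open Matrix Polynomial

theorem signVariations_eq_zero_of_nonneg (m : ℕ) : ∀ (P : ℝ[X]), P.support.card ≤ m →
    (∀ k, 0 ≤ P.coeff k) → P.signVariations = 0 := by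
  induction m with
  | zero =>
    intro P hm _
    have : P = 0 := by simpa using hm
    simp [this]
  | succ m ih =>
    intro P hm hP
    by_cases h0 : P = 0
    · simp [h0]
    have hE : ∀ k, 0 ≤ P.eraseLead.coeff k := by
      intro k
      rw [eraseLead_coeff]
      split_ifs
      · exact le_rfl
      · exact hP k
    rw [signVariations_eq_eraseLead_add_ite h0, ih P.eraseLead ?_ hE, zero_add, if_neg]
    · have h1 : 0 < P.leadingCoeff :=
        lt_of_le_of_ne (hP _) (Ne.symm (leadingCoeff_ne_zero.mpr h0))
      have h2 : 0 ≤ P.eraseLead.leadingCoeff := hE _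
      rcases h2.eq_or_lt with h2 | h2
      · rw [← h2, sign_pos h1]; simp
      · rw [sign_pos h1, sign_pos h2]; decide
    · have := card_support_eraseLead_add_one h0
      omega

/-- [N6]: an N-matrix has exactly one negative real eigenvalue, counted with
algebraic multiplicity. -/
theorem stmt_9 {n : ℕ} (hn : 0 < n) (A : Matrix (Fin n) (Fin n) ℝ)
    (hA : IsNMatrix A) :
    (A.charpoly.roots.filter fun r => r < 0).card = 1 := by
  have hdeg : A.charpoly.natDegree = n := by simp [charpoly_natDegree_eq_dim]
  obtain ⟨Q, hQ⟩ : ∃ Q : ℝ[X], Q = C ((-1) ^ n) * A.charpoly.comp (-X) := ⟨_, rfl⟩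
  have hu : ((-1 : ℝ) ^ n) ≠ 0 := by simp
  have hroots : Q.roots = A.charpoly.roots.map fun x => -x := by
    rw [hQ, roots_C_mul _ hu, roots_comp_neg_X]
  have hcount : (A.charpoly.roots.filter fun r => r < 0).card = Q.roots.countP (0 < ·) := by
    rw [hroots, Multiset.countP_map]
    simp
  have hQdeg : Q.natDegree = n := by
    rw [hQ, natDegree_C_mul hu, natDegree_eq_of_degree_eq (degree_comp_neg_X), hdeg]
  have hQlead : Q.leadingCoeff = 1 := by
    rw [hQ, leadingCoeff_mul, leadingCoeff_C, comp_neg_X_leadingCoeff_eq, hdeg,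
      (charpoly_monic A).leadingCoeff, mul_one, ← mul_pow]
    simp
  have hQ0 : Q ≠ 0 := by
    intro h
    simp [h] at hQlead
  have hneg : ∀ k < n, Q.coeff k < 0 := by
    intro k hk
    have hc := charpoly_coeff_eq_sum_minors A (n - k) (by simp)
    rw [Fintype.card_fin, Nat.sub_sub_self hk.le] at hc
    have hs : ∑ s ∈ (Finset.univ : Finset (Fin n)).powersetCard (n - k),
      (A.submatrix (Subtype.val : s → Fin n) (Subtype.val : s → Fin n)).det < 0 := by
      apply Finset.sum_neg
      · intro s hs
        apply hA
        rw [Finset.mem_powersetCard] at hs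
        rw [← Finset.card_pos]
        omega
      · rw [Finset.powersetCard_nonempty]
        simp
    have hcoef : Q.coeff k = (-1) ^ n * ((-1) ^ k * A.charpoly.coeff k) := by
      rw [hQ, coeff_C_mul, show (-X : ℝ[X]) = C (-1) * X by simp, comp_C_mul_X_coeff,
        mul_comm (A.charpoly.coeff k)]
    have hsgn : ((-1 : ℝ) ^ n * ((-1) ^ k * (-1) ^ (n - k))) = 1 := by
      rw [← pow_add, Nat.add_sub_cancel' hk.le, ← mul_pow]
      simp
    rw [hcoef, hc, ← mul_assoc, ← mul_assoc, mul_assoc ((-1 : ℝ) ^ n), hsgn, one_mul]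
    exact hs
  rw [hcount]
  apply le_antisymm
  · refine (roots_countP_pos_le_signVariations Q).trans ?_
    refine (signVariations_le_eraseLead_succ Q).trans ?_
    rw [← signVariations_neg, signVariations_eq_zero_of_nonneg _ _ le_rfl]
    intro k
    rw [coeff_neg, eraseLead_coeff, hQdeg]
    split_ifs with h
    · simp
    · rcases lt_or_gt_of_ne h with h | h
      · linarith [hneg k h]
      · rw [coeff_eq_zero_of_natDegree_lt (by omega)]; simp
  · rw [Nat.succ_le_iff, Multiset.countP_pos]
    have h0 : Q.eval 0 < 0 := by
      rw [← coeff_zero_eq_eval_zero]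
      exact hneg 0 hn
    have ht := tendsto_atTop_of_leadingCoeff_nonneg Q
      (natDegree_pos_iff_degree_pos.mp (by omega)) (by rw [hQlead]; exact zero_le_one)
    obtain ⟨b, hb1, hb2⟩ := ((ht.eventually_ge_atTop 0).and
      (Filter.eventually_gt_atTop (0 : ℝ))).exists
    obtain ⟨x, hx, hx0⟩ := intermediate_value_Icc hb2.le Q.continuous.continuousOn ⟨h0.le, hb1⟩
    refine ⟨x, (mem_roots hQ0).mpr hx0, lt_of_le_of_ne hx.1 ?_⟩
    rintro rfl
    exact absurd hx0 h0.ne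
end

section
/- Let A be a real n×n matrix with all entries negative. Then A is an N-matrix if and only if for every q ∈ ℝⁿ with q > 0 entrywise, the linear complementarity problem LCP(A, q) has exactly two solutions; that is, the set { z ∈ ℝⁿ : z ≥ 0, Az + q ≥ 0, zᵀ(Az + q) = 0 } has exactly two elements. -/
open Matrix

section helpers

variable {m : Type*} [Fintype m] [DecidableEq m]

/-- The matrix with rows of `A` on `s` and rows of the identity elsewhere. -/
def pmat (A : Matrix m m ℝ) (s : Finset m) : Matrix m m ℝ :=
  Matrix.of fun i => if i ∈ s then A i else (1 : Matrix m m ℝ) i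

/-- Principal minor. -/
noncomputable def pmin (A : Matrix m m ℝ) (s : Finset m) : ℝ := (pmat A s).det

lemma pmin_eq (A : Matrix m m ℝ) (s : Finset m) :
    pmin A s = (A.submatrix (fun i : s => (i : m)) (fun j : s => (j : m))).det := by
  unfold pmin
  rw [Matrix.twoBlockTriangular_det (pmat A s) (fun i => i ∈ s)]
  · have h2 : (pmat A s).toSquareBlockProp (fun i => ¬ i ∈ s) = 1 := by
      ext i j
      have := i.2
      simp [Matrix.toSquareBlockProp, pmat, this, Matrix.one_apply, Subtype.ext_iff]
    have h1 : (pmat A s).toSquareBlockProp (fun i => i ∈ s)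
        = A.submatrix (fun i : s => (i : m)) (fun j : s => (j : m)) := by
      ext i j
      have := i.2
      simp [Matrix.toSquareBlockProp, pmat]
    rw [h2, h1, Matrix.det_one, mul_one]
    congr!
  · intro i hi j hj
    have : i ≠ j := by rintro rfl; exact hi hj
    simp [pmat, hi, this]

lemma pmin_congr {A B : Matrix m m ℝ} {s : Finset m} (h : ∀ i ∈ s, A i = B i) :
    pmin A s = pmin B s := by
  unfold pmin
  congr 1
  ext i j
  by_cases hi : i ∈ s
  · simp [pmat, hi, h i hi]
  · simp [pmat, hi]

lemma pmin_step (A : Matrix m m ℝ) {s : Finset m} {i : m} (hi : i ∈ s) (e : ℝ) :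
    pmin (A + diagonal (Pi.single i e)) s = pmin A s + e * pmin A (s.erase i) := by
  unfold pmin
  have h1 : pmat (A + diagonal (Pi.single i e)) s
      = (pmat A s).updateRow i ((pmat A s) i + e • (1 : Matrix m m ℝ) i) := by
    ext k j
    by_cases hk : k = i
    · subst hk
      by_cases hj : k = j
      · subst hj; simp [pmat, hi]
      · simp [pmat, hi, hj]
    · by_cases hs : k ∈ s
      · by_cases hj : k = j
        · subst hj; simp [pmat, hs, hk]
        · simp [pmat, hs, hk, hj]
      · simp [pmat, hs, hk]
  have h2 : pmat A (s.erase i) = (pmat A s).updateRow i ((1 : Matrix m m ℝ) i) := by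
    ext k j
    by_cases hk : k = i
    · subst hk; simp [pmat]
    · simp [pmat, hk]
  rw [h1, det_updateRow_add, det_updateRow_smul, updateRow_eq_self, h2]

lemma pmin_diag_notMem (A : Matrix m m ℝ) {s : Finset m} {i : m} (hi : i ∉ s) (e : ℝ) :
    pmin (A + diagonal (Pi.single i e)) s = pmin A s := by
  apply pmin_congr
  intro k hk
  have : k ≠ i := by rintro rfl; exact hi hk
  ext j
  by_cases hj : k = j
  · subst hj; simp [this]
  · simp [hj]

lemma pmin_eq_zero_iff (M : Matrix m m ℝ) (s : Finset m) :
    pmin M s = 0 ↔ ∃ x : m → ℝ, x ≠ 0 ∧ (∀ i ∉ s, x i = 0) ∧ ∀ i ∈ s, (M *ᵥ x) i = 0 := by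
  unfold pmin
  rw [← Matrix.exists_mulVec_eq_zero_iff]
  have key : ∀ (x : m → ℝ) i, (pmat M s *ᵥ x) i = if i ∈ s then (M *ᵥ x) i else x i := by
    intro x i
    by_cases hi : i ∈ s
    · simp [pmat, Matrix.mulVec, hi]
    · have : (pmat M s *ᵥ x) i = ((1 : Matrix m m ℝ) *ᵥ x) i := by
        simp only [pmat, Matrix.mulVec, hi, Matrix.of_apply, if_false]
      rw [this]; simp [hi]
  constructor
  · rintro ⟨x, hx, h⟩
    refine ⟨x, hx, fun i hi => ?_, fun i hi => ?_⟩
    · have := key x i; rw [h] at this; simpa [hi] using this.symm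
    · have := key x i; rw [h] at this; simpa [hi] using this.symm
  · rintro ⟨x, hx, h1, h2⟩
    refine ⟨x, hx, ?_⟩
    ext i
    rw [key]
    by_cases hi : i ∈ s
    · simp [hi, h2 i hi]
    · simp [hi, h1 i hi]

lemma diag_insert (M : Matrix m m ℝ) (d : m → ℝ) {T : Finset m} {j : m} (hj : j ∉ T) :
    M + diagonal (fun k => if k ∈ insert j T then d k else 0)
      = (M + diagonal (fun k => if k ∈ T then d k else 0)) + diagonal (Pi.single j (d j)) := by
  rw [add_assoc, diagonal_add]
  congr 2
  ext k
  by_cases hk : k = j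
  · subst hk; simp [hj]
  · simp [hk]

lemma pmin_neg_aux {A : Matrix m m ℝ} (hA : ∀ s : Finset m, s.Nonempty → pmin A s < 0)
    {d : m → ℝ} (hd : ∀ i, 0 ≤ d i) (i : m) (T : Finset m) :
    i ∉ T → ∀ s : Finset m, i ∈ s →
      pmin (A + diagonal (fun k => if k ∈ T then d k else 0)) s < 0 := by
  induction T using Finset.induction_on with
  | empty => 
    intro _ s hs
    simpa using hA s ⟨i, hs⟩
  | insert j T hj ih =>
    intro hi s hs
    rw [Finset.mem_insert, not_or] at hi
    rw [diag_insert _ _ hj]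
    by_cases hjs : j ∈ s
    · rw [pmin_step _ hjs]
      have h1 := ih hi.2 s hs
      have h2 := ih hi.2 (s.erase j) (Finset.mem_erase.2 ⟨hi.1, hs⟩)
      have := mul_nonpos_of_nonneg_of_nonpos (hd j) h2.le
      linarith
    · rw [pmin_diag_notMem _ hjs]
      exact ih hi.2 s hs

lemma pmin_mono_aux {M : Matrix m m ℝ} {P : Finset m} (hM : ∀ s ⊆ P, 0 < pmin M s)
    {d : m → ℝ} (hd : ∀ i, 0 ≤ d i) (T : Finset m) :
    ∀ s ⊆ P, 0 < pmin (M + diagonal (fun k => if k ∈ T then d k else 0)) s := by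
  induction T using Finset.induction_on with
  | empty => 
    intro s hs
    simpa using hM s hs
  | insert j T hj ih =>
    intro s hs
    rw [diag_insert _ _ hj]
    by_cases hjs : j ∈ s
    · rw [pmin_step _ hjs]
      have h1 := ih s hs
      have h2 := ih (s.erase j) ((Finset.erase_subset _ _).trans hs)
      have := mul_nonneg (hd j) h2.le
      linarith
    · rw [pmin_diag_notMem _ hjs]
      exact ih s hs

lemma pmin_erase_pos {A : Matrix m m ℝ} (hA : ∀ s : Finset m, s.Nonempty → pmin A s < 0)
    {d : m → ℝ} (hd : ∀ i, 0 ≤ d i) {s : Finset m} (hs : 0 ≤ pmin (A + diagonal d) s)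
    {i : m} (hi : i ∈ s) : 0 < pmin (A + diagonal d) (s.erase i) := by
  have h0 := pmin_neg_aux hA hd i (Finset.univ.erase i) (by simp) s hi
  have h1 := diag_insert A d (T := Finset.univ.erase i) (j := i) (by simp)
  rw [Finset.insert_erase (Finset.mem_univ i)] at h1
  simp only [Finset.mem_univ, if_true] at h1
  have h1' : A + diagonal d = _ := h1
  rw [h1'] at hs ⊢
  rw [pmin_diag_notMem _ (by simp)]
  rw [pmin_step _ hi] at hs
  by_contra hcon
  push Not at hcon
  have := mul_nonpos_of_nonneg_of_nonpos (hd i) hcon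
  linarith

lemma pmin_proper_pos {A : Matrix m m ℝ} (hA : ∀ s : Finset m, s.Nonempty → pmin A s < 0)
    {d : m → ℝ} (hd : ∀ i, 0 ≤ d i) (s : Finset m) :
    0 ≤ pmin (A + diagonal d) s → ∀ t ⊂ s, 0 < pmin (A + diagonal d) t := by
  induction s using Finset.strongInduction with
  | H s ih =>
    intro hs t ht
    obtain ⟨i, hi, hit⟩ := Finset.exists_of_ssubset ht
    have h := pmin_erase_pos hA hd hs hi
    have hsub : t ⊆ s.erase i := fun k hk =>
      Finset.mem_erase.2 ⟨by rintro rfl; exact hit hk, ht.1 hk⟩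
    rcases hsub.eq_or_ssubset with h' | h'
    · rw [h']; exact h
    · exact ih _ (Finset.erase_ssubset hi) h.le t h'

lemma nonreversal {A : Matrix m m ℝ} (hneg : ∀ i j, A i j < 0)
    (hA : ∀ s : Finset m, s.Nonempty → pmin A s < 0) (x : m → ℝ)
    (hx : ∀ i, x i * (A *ᵥ x) i ≤ 0) : (∀ i, 0 ≤ x i) ∨ (∀ i, x i ≤ 0) := by
  by_contra hcon
  push Not at hcon
  obtain ⟨⟨a, ha⟩, ⟨b, hb⟩⟩ := hcon
  set d : m → ℝ := fun i => - (A *ᵥ x) i / x i with hd_def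
  have hdx : ∀ i, x i ≠ 0 → d i * x i = - (A *ᵥ x) i := fun i hi => by
    simp only [hd_def]; field_simp
  have hd : ∀ i, 0 ≤ d i := by
    intro i
    by_cases hi : x i = 0
    · simp [hd_def, hi]
    · have h1 : d i = (- (x i * (A *ᵥ x) i)) / (x i)^2 := by
        simp only [hd_def]; field_simp
      rw [h1]
      apply div_nonneg _ (sq_nonneg _)
      linarith [hx i]
  set s : Finset m := Finset.univ.filter (fun i => x i ≠ 0) with hs
  set P : Finset m := Finset.univ.filter (fun i => 0 < x i) with hP
  have hzero : pmin (A + diagonal d) s = 0 := by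
    rw [pmin_eq_zero_iff]
    refine ⟨x, ?_, ?_, ?_⟩
    · rintro rfl; simp at ha
    · intro i hi; simpa [hs] using hi
    · intro i hi
      have hi' : x i ≠ 0 := by simpa [hs] using hi
      rw [Matrix.add_mulVec, Pi.add_apply, Matrix.mulVec_diagonal, hdx i hi']; ring
  have hPs : P ⊂ s := by
    rw [Finset.ssubset_iff_of_subset]
    · refine ⟨a, ?_, ?_⟩
      · simp [hs, ha.ne]
      · simp [hP, ha.le]
    · intro i hi
      simp only [hP, hs, Finset.mem_filter, Finset.mem_univ, true_and] at hi ⊢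
      exact hi.ne'
  have hpos : ∀ t ⊆ P, 0 < pmin (A + diagonal d) t := fun t ht =>
    pmin_proper_pos hA hd s hzero.ge t (lt_of_le_of_lt ht hPs)
  set u : m → ℝ := fun i => max (x i) 0 with hu
  have hAu : ∀ i, (A *ᵥ u) i ≤ (A *ᵥ x) i := by
    intro i
    simp only [Matrix.mulVec, dotProduct]
    apply Finset.sum_le_sum
    intro j _
    exact mul_le_mul_of_nonpos_left (le_max_left _ _) (hneg i j).le
  set E : m → ℝ := fun i => - ((A *ᵥ u) i + d i * u i) / u i with hE_def
  have huP : ∀ i, 0 < x i → u i = x i := fun i hi => max_eq_left hi.le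
  have huN : ∀ i, ¬ 0 < x i → u i = 0 := fun i hi => max_eq_right (not_lt.1 hi)
  have hE : ∀ i, 0 ≤ E i := by
    intro i
    by_cases hi : 0 < x i
    · have h1 := hdx i hi.ne'
      simp only [hE_def]
      apply div_nonneg
      · rw [huP i hi, h1]; linarith [hAu i]
      · exact le_max_right _ _
    · simp [hE_def, huN i hi]
  have hfin := pmin_mono_aux hpos hE Finset.univ P subset_rfl
  simp only [Finset.mem_univ, if_true] at hfin
  have hz2 : pmin (A + diagonal d + diagonal (fun k => E k)) P = 0 := by
    rw [pmin_eq_zero_iff]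
    refine ⟨u, ?_, ?_, ?_⟩
    · intro h
      have := congrFun h b
      rw [huP b hb] at this
      simp at this; linarith
    · intro i hi; exact huN i (by simpa [hP] using hi)
    · intro i hi
      have hi' : 0 < x i := by simpa [hP] using hi
      have h3 : E i * u i = - ((A *ᵥ u) i + d i * u i) := by
        have : u i ≠ 0 := by rw [huP i hi']; exact hi'.ne'
        simp only [hE_def]; field_simp
      rw [Matrix.add_mulVec, Matrix.add_mulVec, Pi.add_apply, Pi.add_apply,
        Matrix.mulVec_diagonal, Matrix.mulVec_diagonal, h3]; ring
  linarith

lemma mulVec_neg_of {A : Matrix m m ℝ} (hneg : ∀ i j, A i j < 0) {x : m → ℝ}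
    (hx : ∀ i, 0 ≤ x i) (hx0 : x ≠ 0) (i : m) : (A *ᵥ x) i < 0 := by
  obtain ⟨j, hj⟩ := Function.ne_iff.1 hx0
  have hj' : 0 < x j := lt_of_le_of_ne (hx j) (Ne.symm hj)
  simp only [Matrix.mulVec, dotProduct]
  have := Finset.sum_lt_sum (s := Finset.univ) (f := fun k => A i k * x k) (g := fun _ => (0:ℝ))
    (fun k _ => mul_nonpos_of_nonpos_of_nonneg (hneg i k).le (hx k))
    ⟨j, Finset.mem_univ _, mul_neg_of_neg_of_pos (hneg i j) hj'⟩
  simpa using this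

/-- nontrivial solutions of the subproblem on `s` -/
def Sol (A : Matrix m m ℝ) (s : Finset m) (q z : m → ℝ) : Prop :=
  (∀ i, 0 ≤ z i) ∧ (∀ i ∉ s, z i = 0) ∧ (∀ i ∈ s, 0 ≤ (A *ᵥ z) i + q i) ∧
    (∀ i ∈ s, z i * ((A *ᵥ z) i + q i) = 0) ∧ ∃ i ∈ s, (A *ᵥ z) i + q i = 0

lemma Sol.unique {A : Matrix m m ℝ} (hneg : ∀ i j, A i j < 0)
    (hA : ∀ s : Finset m, s.Nonempty → pmin A s < 0) {s : Finset m} {q z z' : m → ℝ}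
    (h : Sol A s q z) (h' : Sol A s q z') : z = z' := by
  have main : ∀ {z z' : m → ℝ}, Sol A s q z → Sol A s q z' → (∀ i, 0 ≤ (z - z') i) → z = z' := by
    intro z z' h h' hx
    by_contra hne
    have hx0 : z - z' ≠ 0 := sub_ne_zero.2 hne
    obtain ⟨i, hi, hi0⟩ := h'.2.2.2.2
    have h1 := mulVec_neg_of hneg hx hx0 i
    rw [Matrix.mulVec_sub, Pi.sub_apply] at h1
    have := h.2.2.1 i hi
    linarith
  have hrev : ∀ i, (z - z') i * (A *ᵥ (z - z')) i ≤ 0 := by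
    intro i
    rw [Matrix.mulVec_sub, Pi.sub_apply, Pi.sub_apply]
    by_cases hi : i ∈ s
    · have h1 := h.2.2.2.1 i hi
      have h2 := h'.2.2.2.1 i hi
      have h3 := mul_nonneg (h.1 i) (h'.2.2.1 i hi)
      have h4 := mul_nonneg (h'.1 i) (h.2.2.1 i hi)
      nlinarith
    · rw [h.2.1 i hi, h'.2.1 i hi]; simp
  rcases nonreversal hneg hA _ hrev with hx | hx
  · exact main h h' hx
  · refine (main h' h fun i => ?_).symm
    have := hx i
    simp only [Pi.sub_apply] at this ⊢
    linarith

lemma isClosed_Sol (A : Matrix m m ℝ) (s : Finset m) (q c : m → ℝ) :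
    IsClosed {p : ℝ × (m → ℝ) | Sol A s (q + p.1 • c) p.2} := by
  have hc : ∀ i, Continuous fun p : ℝ × (m → ℝ) => (A *ᵥ p.2) i + (q + p.1 • c) i := by
    intro i
    simp only [Matrix.mulVec, dotProduct, Pi.add_apply, Pi.smul_apply, smul_eq_mul]
    fun_prop
  have hz : ∀ i, Continuous fun p : ℝ × (m → ℝ) => p.2 i := by intro i; fun_prop
  have e : {p : ℝ × (m → ℝ) | Sol A s (q + p.1 • c) p.2} =
    (⋂ i, {p | 0 ≤ p.2 i}) ∩ ((⋂ i, ⋂ (_ : i ∉ s), {p | p.2 i = 0}) ∩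
     ((⋂ i, ⋂ (_ : i ∈ s), {p | 0 ≤ (A *ᵥ p.2) i + (q + p.1 • c) i}) ∩
     ((⋂ i, ⋂ (_ : i ∈ s), {p | p.2 i * ((A *ᵥ p.2) i + (q + p.1 • c) i) = 0}) ∩
     (⋃ i ∈ s, {p | (A *ᵥ p.2) i + (q + p.1 • c) i = 0})))) := by
    ext p
    simp only [Sol, Set.mem_setOf_eq, Set.mem_inter_iff, Set.mem_iInter, Set.mem_iUnion, exists_prop]
  rw [e]
  refine (isClosed_iInter fun i => isClosed_le continuous_const (hz i)).inter
    ((isClosed_iInter fun i => isClosed_iInter fun _ => isClosed_eq (hz i) continuous_const).inter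
    ((isClosed_iInter fun i => isClosed_iInter fun _ => isClosed_le continuous_const (hc i)).inter
    ((isClosed_iInter fun i => isClosed_iInter fun _ =>
      isClosed_eq ((hz i).mul (hc i)) continuous_const).inter ?_)))
  exact s.finite_toSet.isClosed_biUnion fun i _ => isClosed_eq (hc i) continuous_const

lemma Sol.bound {A : Matrix m m ℝ} (hneg : ∀ i j, A i j < 0) {s : Finset m} {q z : m → ℝ}
    (h : Sol A s q z) {k : m} (hk : k ∈ s) (i : m) : z i ≤ q k / (- A k i) := by
  rw [le_div_iff₀ (by linarith [hneg k i])]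
  have h1 := h.2.2.1 k hk
  have h2 : (A *ᵥ z) k ≤ A k i * z i := by
    simp only [Matrix.mulVec, dotProduct]
    rw [← Finset.add_sum_erase _ _ (Finset.mem_univ i)]
    have : ∑ x ∈ Finset.univ.erase i, A k x * z x ≤ 0 :=
      Finset.sum_nonpos fun x _ => mul_nonpos_of_nonpos_of_nonneg (hneg k x).le (h.1 x)
    linarith
  linarith

lemma mulVec_add_single (A : Matrix m m ℝ) (z : m → ℝ) (j : m) (t : ℝ) (i : m) :
    (A *ᵥ (z + Pi.single j t)) i = (A *ᵥ z) i + t * A i j := by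
  rw [Matrix.mulVec_add, Pi.add_apply, Matrix.mulVec_single]
  simp [mul_comm]

lemma Sol.exists {A : Matrix m m ℝ} (hneg : ∀ i j, A i j < 0)
    (hA : ∀ s : Finset m, s.Nonempty → pmin A s < 0) (s : Finset m) : s.Nonempty →
    ∀ q : m → ℝ, (∀ i ∈ s, 0 ≤ q i) → ∃ z, Sol A s q z := by
  have zeroSol : ∀ (s : Finset m) (q : m → ℝ), (∀ i ∈ s, 0 ≤ q i) → (∃ i ∈ s, q i = 0) →
      Sol A s q 0 := by
    intro s q hq h
    refine ⟨by simp, by simp, by simpa using hq, by simp, by simpa using h⟩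
  induction s using Finset.induction_on with
  | empty => simp
  | insert j s hj ih =>
    intro _ q hq
    by_cases hq0 : ∃ i ∈ insert j s, q i = 0
    · exact ⟨0, zeroSol _ _ hq hq0⟩
    have hqp : ∀ i ∈ insert j s, 0 < q i := fun i hi =>
      lt_of_le_of_ne (hq i hi) fun h => hq0 ⟨i, hi, h.symm⟩
    have hqj : 0 < q j := hqp j (Finset.mem_insert_self _ _)
    -- the single solution
    have hsingle : (∀ i ∈ s, 0 ≤ q i + (q j / (- A j j)) * A i j) →
        ∃ z, Sol A (insert j s) q z := by
      intro hh
      have hjj : (q j / (- A j j)) * A j j = - q j := by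
        have := (hneg j j).ne
        field_simp
      have hm : ∀ i, (A *ᵥ (Pi.single j (q j / (- A j j)))) i = (q j / (- A j j)) * A i j := by
        intro i
        have := mulVec_add_single A 0 j (q j / (- A j j)) i
        simpa using this
      refine ⟨Pi.single j (q j / (- A j j)), ?_, ?_, ?_, ?_, ⟨j, Finset.mem_insert_self _ _, ?_⟩⟩
      · intro i
        by_cases hi : i = j
        · subst hi
          simp only [Pi.single_eq_same]
          exact div_nonneg hqj.le (by linarith [hneg i i])
        · simp [hi]
      · intro i hi
        have : i ≠ j := by rintro rfl; simp at hi
        simp [this]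
      · intro i hi
        rw [hm]
        rcases Finset.mem_insert.1 hi with rfl | hi
        · rw [hjj]; simp
        · linarith [hh i hi]
      · intro i hi
        rw [hm]
        by_cases hij : i = j
        · subst hij; rw [hjj]; simp
        · simp [hij]
      · rw [hm, hjj]; simp
    rcases s.eq_empty_or_nonempty with rfl | hs
    · exact hsingle (by simp)
    obtain ⟨k, hk, hkmin⟩ := s.exists_min_image (fun i => q i / (- A i j)) hs
    set τ := q k / (- A k j) with hτ
    have hτ0 : 0 ≤ τ := div_nonneg (hqp k (Finset.mem_insert_of_mem hk)).le (by linarith [hneg k j])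
    set c : m → ℝ := fun i => A i j with hc
    have hqt : ∀ t, t ≤ τ → ∀ i ∈ s, 0 ≤ (q + t • c) i := by
      intro t ht i hi
      have h1 : t ≤ q i / (- A i j) := ht.trans (hkmin i hi)
      rw [le_div_iff₀ (by linarith [hneg i j])] at h1
      simp only [Pi.add_apply, Pi.smul_apply, smul_eq_mul, hc]
      linarith
    have hqk : (q + τ • c) k = 0 := by
      have := (hneg k j).ne
      simp only [Pi.add_apply, Pi.smul_apply, smul_eq_mul, hc, hτ]
      field_simp
      ring
    by_cases hcase : q j / (- A j j) ≤ τ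
    · exact hsingle fun i hi => by simpa [hc] using hqt _ hcase i hi
    push Not at hcase
    have hτj : 0 ≤ q j + τ * A j j := by
      rw [lt_div_iff₀ (by linarith [hneg j j])] at hcase
      linarith
    -- extension of a solution
    have hext : ∀ t z, 0 ≤ t → Sol A s (q + t • c) z → 0 ≤ (A *ᵥ z) j + (q + t • c) j →
        t * ((A *ᵥ z) j + (q + t • c) j) = 0 → ∃ z, Sol A (insert j s) q z := by
      intro t z ht hz h0 h1
      have hm : ∀ i, (A *ᵥ (z + Pi.single j t)) i + q i = (A *ᵥ z) i + (q + t • c) i := by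
        intro i
        rw [mulVec_add_single]
        simp only [Pi.add_apply, Pi.smul_apply, smul_eq_mul, hc]; ring
      have hzj : z j = 0 := hz.2.1 j hj
      refine ⟨z + Pi.single j t, ?_, ?_, ?_, ?_, ?_⟩
      · intro i
        by_cases hi : i = j
        · subst hi; simpa [hzj] using ht
        · simpa [hi] using hz.1 i
      · intro i hi
        rw [Finset.mem_insert, not_or] at hi
        simpa [hi.1] using hz.2.1 i hi.2
      · intro i hi
        rw [hm]
        rcases Finset.mem_insert.1 hi with rfl | hi
        · exact h0
        · exact hz.2.2.1 i hi
      · intro i hi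
        rw [hm]
        by_cases hij : i = j
        · subst hij
          rw [Pi.add_apply, hzj, Pi.single_eq_same, zero_add]; exact h1
        · rw [Pi.add_apply, Pi.single_eq_of_ne hij, add_zero]
          exact hz.2.2.2.1 i (Finset.mem_of_mem_insert_of_ne hi hij)
      · obtain ⟨i, hi, h⟩ := hz.2.2.2.2
        exact ⟨i, Finset.mem_insert_of_mem hi, by rw [hm]; exact h⟩
    let W : ℝ × (m → ℝ) → ℝ := fun p => (A *ᵥ p.2) j + (q + p.1 • c) j
    have hW : Continuous W := by
      simp only [W, Matrix.mulVec, dotProduct, Pi.add_apply, Pi.smul_apply, smul_eq_mul]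
      fun_prop
    obtain ⟨z0, hz0⟩ := ih hs (q + (0:ℝ) • c) (hqt 0 hτ0)
    by_cases hW0 : 0 ≤ W (0, z0)
    · exact hext 0 z0 le_rfl hz0 hW0 (by simp)
    let K : Set (ℝ × (m → ℝ)) := {p | Sol A s (q + p.1 • c) p.2} ∩
      (Set.Icc 0 τ ×ˢ Set.Icc 0 (fun i => q k / (- A k i)))
    have hK : IsCompact K := (isCompact_Icc.prod isCompact_Icc).inter_left (isClosed_Sol A s q c)
    have hmemK : ∀ t z, 0 ≤ t → t ≤ τ → Sol A s (q + t • c) z → (t, z) ∈ K := by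
      intro t z h0 h1 h
      refine ⟨h, ⟨h0, h1⟩, fun i => h.1 i, fun i => ?_⟩
      refine (h.bound hneg hk i).trans ?_
      apply div_le_div_of_nonneg_right _ (by linarith [hneg k i])
      simp only [Pi.add_apply, Pi.smul_apply, smul_eq_mul, hc]
      have := mul_nonpos_of_nonneg_of_nonpos h0 (hneg k j).le
      linarith
    have hC1 : IsClosed (Prod.fst '' (K ∩ {p | 0 ≤ W p})) :=
      ((hK.inter_right (isClosed_le continuous_const hW)).image continuous_fst).isClosed
    have hC2 : IsClosed (Prod.fst '' (K ∩ {p | W p ≤ 0})) :=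
      ((hK.inter_right (isClosed_le hW continuous_const)).image continuous_fst).isClosed
    have hconn := isPreconnected_closed_iff.1 (isPreconnected_Icc (a := (0:ℝ)) (b := τ))
      _ _ hC1 hC2 ?_ ?_ ?_
    · obtain ⟨t, ht, ⟨⟨t1, z1⟩, ⟨h1K, h1W⟩, h1⟩, ⟨⟨t2, z2⟩, ⟨h2K, h2W⟩, h2⟩⟩ := hconn
      simp only at h1 h2
      subst h1
      subst h2
      have hz : z2 = z1 := Sol.unique hneg hA h2K.1 h1K.1
      subst hz
      have hw : W (t2, z2) = 0 := le_antisymm h2W h1W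
      exact hext t2 z2 ht.1 h1K.1 h1W (by change t2 * W (t2, z2) = 0; rw [hw, mul_zero])
    · intro t ht
      obtain ⟨z, hz⟩ := ih hs (q + t • c) (hqt t ht.2)
      rcases le_total 0 (W (t, z)) with h | h
      · exact Or.inl ⟨(t, z), ⟨hmemK t z ht.1 ht.2 hz, h⟩, rfl⟩
      · exact Or.inr ⟨(t, z), ⟨hmemK t z ht.1 ht.2 hz, h⟩, rfl⟩
    · refine ⟨τ, ⟨hτ0, le_rfl⟩, (τ, 0), ⟨hmemK τ 0 hτ0 le_rfl
        (zeroSol s _ (hqt τ le_rfl) ⟨k, hk, hqk⟩), ?_⟩, rfl⟩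
      simpa [W, hc] using hτj
    · exact ⟨0, ⟨le_rfl, hτ0⟩, (0, z0), ⟨hmemK 0 z0 le_rfl hτ0 hz0, (not_le.1 hW0).le⟩, rfl⟩

/-- solution set of the LCP -/
lemma lcp_comp {A : Matrix m m ℝ} {q z : m → ℝ} (h0 : ∀ i, 0 ≤ z i)
    (h1 : ∀ i, 0 ≤ (A *ᵥ z + q) i) :
    z ⬝ᵥ (A *ᵥ z + q) = 0 ↔ ∀ i, z i * ((A *ᵥ z) i + q i) = 0 := by
  simp only [dotProduct]
  rw [Finset.sum_eq_zero_iff_of_nonneg fun i _ => mul_nonneg (h0 i) (h1 i)]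
  simp

lemma neg_of_nonreversal {A : Matrix m m ℝ} (hneg : ∀ i j, A i j < 0)
    (h : ∀ x : m → ℝ, (∀ i, x i * (A *ᵥ x) i ≤ 0) → (∀ i, 0 ≤ x i) ∨ (∀ i, x i ≤ 0))
    (s : Finset m) : s.Nonempty → pmin A s < 0 := by
  induction s using Finset.induction_on with
  | empty => simp
  | insert i s hi ih =>
    intro _
    have hstep := pmin_step A (Finset.mem_insert_self i s)
    rw [Finset.erase_insert hi] at hstep
    rcases s.eq_empty_or_nonempty with rfl | hs
    · rw [pmin_eq]
      have : Unique ↥(insert i (∅ : Finset m)) :=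
        { default := ⟨i, by simp⟩, uniq := fun a => Subtype.ext (by simpa using a.2) }
      rw [Matrix.det_unique]
      exact hneg _ _
    · have hb := ih hs
      by_contra hcon
      push Not at hcon
      set e := - pmin A (insert i s) / pmin A s with he
      have he0 : 0 ≤ e := div_nonneg_of_nonpos (by linarith) hb.le
      have hz : pmin (A + diagonal (Pi.single i e)) (insert i s) = 0 := by
        rw [hstep, he, div_mul_cancel₀ _ hb.ne]; ring
      obtain ⟨x, hx0, hx1, hx2⟩ := (pmin_eq_zero_iff _ _).1 hz
      have hx2' : ∀ k ∈ insert i s, (A *ᵥ x) k + (Pi.single i e : m → ℝ) k * x k = 0 := by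
        intro k hk
        have := hx2 k hk
        rwa [Matrix.add_mulVec, Pi.add_apply, Matrix.mulVec_diagonal] at this
      obtain ⟨j, hjs⟩ := hs
      have hji : j ≠ i := by rintro rfl; exact hi hjs
      have hAj : (A *ᵥ x) j = 0 := by
        have := hx2' j (Finset.mem_insert_of_mem hjs)
        simpa [hji] using this
      have hrev : ∀ k, x k * (A *ᵥ x) k ≤ 0 := by
        intro k
        by_cases hk : k ∈ insert i s
        · have h1 := hx2' k hk
          by_cases hki : k = i
          · subst hki
            rw [Pi.single_eq_same] at h1
            have : (A *ᵥ x) k = - (e * x k) := by linarith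
            rw [this]
            nlinarith [mul_nonneg he0 (mul_self_nonneg (x k))]
          · rw [Pi.single_eq_of_ne hki] at h1
            have : (A *ᵥ x) k = 0 := by linarith
            rw [this]; simp
        · rw [hx1 k hk]; simp
      rcases h x hrev with hp | hn
      · exact absurd hAj (mulVec_neg_of hneg hp hx0 j).ne
      · have := mulVec_neg_of hneg (x := -x) (fun k => by simpa using hn k) (neg_ne_zero.2 hx0) j
        rw [Matrix.mulVec_neg, Pi.neg_apply, hAj] at this
        simp at this

end helpers

/-- [N2]: a matrix with all entries negative is an N-matrix iff for every
entrywise positive `q`, the linear complementarity problem LCP(A, q) has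
exactly two solutions. -/
theorem stmt_10 {n : ℕ} (hn : 0 < n) (A : Matrix (Fin n) (Fin n) ℝ)
    (hneg : ∀ i j, A i j < 0) :
    IsNMatrix A ↔
      ∀ q : Fin n → ℝ, (∀ i, 0 < q i) →
        {z : Fin n → ℝ | (∀ i, 0 ≤ z i) ∧ (∀ i, 0 ≤ (A.mulVec z + q) i) ∧
          z ⬝ᵥ (A.mulVec z + q) = 0}.ncard = 2 := by
  constructor
  · intro hN q hq
    have hA : ∀ s : Finset (Fin n), s.Nonempty → pmin A s < 0 := fun s hs => by
      rw [pmin_eq]; exact hN s hs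
    obtain ⟨z, hz⟩ := Sol.exists hneg hA Finset.univ ⟨⟨0, hn⟩, Finset.mem_univ _⟩ q
      (fun i _ => (hq i).le)
    rw [Set.ncard_eq_two]
    refine ⟨0, z, ?_, ?_⟩
    · rintro rfl
      obtain ⟨i, _, hi⟩ := hz.2.2.2.2
      have := hq i
      simp at hi
      linarith
    · ext y
      simp only [Set.mem_setOf_eq, Set.mem_insert_iff, Set.mem_singleton_iff]
      constructor
      · rintro ⟨h0, h1, h2⟩
        by_cases hy : y = 0
        · exact Or.inl hy
        right
        rw [lcp_comp h0 h1] at h2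
        obtain ⟨i, hi⟩ := Function.ne_iff.1 hy
        refine Sol.unique hneg hA (s := Finset.univ) (q := q) ⟨h0, by simp, fun i _ => h1 i,
          fun i _ => h2 i, i, Finset.mem_univ _, ?_⟩ hz
        exact (mul_eq_zero.1 (h2 i)).resolve_left hi
      · rintro (rfl | rfl)
        · refine ⟨by simp, fun i => ?_, by simp⟩
          simpa using (hq i).le
        · have h1 : ∀ i, 0 ≤ (A *ᵥ y + q) i := fun i => hz.2.2.1 i (Finset.mem_univ _)
          exact ⟨hz.1, h1, (lcp_comp hz.1 h1).2 fun i => hz.2.2.2.1 i (Finset.mem_univ _)⟩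
  · intro H s hs
    rw [← pmin_eq]
    refine neg_of_nonreversal hneg ?_ s hs
    intro x hx
    by_contra hcon
    push Not at hcon
    obtain ⟨⟨a, ha⟩, ⟨b, hb⟩⟩ := hcon
    set u : Fin n → ℝ := fun i => max (x i) 0 with hu
    set v : Fin n → ℝ := fun i => max (- x i) 0 with hv
    have hub : u b ≠ 0 := by simp only [hu]; rw [max_eq_left hb.le]; exact hb.ne'
    have hvb : v b = 0 := by simp only [hv]; exact max_eq_right (by linarith)
    have hva : v a ≠ 0 := by simp only [hv]; rw [max_eq_left (by linarith)]; linarith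
    have hu0 : u ≠ 0 := fun h => hub (by rw [h]; rfl)
    have hv0 : v ≠ 0 := fun h => hva (by rw [h]; rfl)
    have huv : u ≠ v := fun h => hub (by rw [h]; exact hvb)
    have hup : ∀ i, 0 ≤ u i := fun i => le_max_right _ _
    have hvp : ∀ i, 0 ≤ v i := fun i => le_max_right _ _
    have hxuv : x = u - v := by
      ext i
      simp only [hu, hv, Pi.sub_apply]
      rcases le_total 0 (x i) with h | h
      · rw [max_eq_left h, max_eq_right (by linarith)]; ring
      · rw [max_eq_right h, max_eq_left (by linarith)]; ring
    have hAx : ∀ i, (A *ᵥ x) i = (A *ᵥ u) i - (A *ᵥ v) i := by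
      intro i; rw [hxuv, Matrix.mulVec_sub, Pi.sub_apply]
    set q : Fin n → ℝ := fun i => max (- (A *ᵥ u) i) (- (A *ᵥ v) i) with hq
    have hqpos : ∀ i, 0 < q i := fun i =>
      lt_of_lt_of_le (by linarith [mulVec_neg_of hneg hup hu0 i]) (le_max_left _ _)
    have hcard := H q hqpos
    have hw1 : ∀ i, 0 ≤ (A *ᵥ u + q) i := fun i => by
      have : - (A *ᵥ u) i ≤ q i := le_max_left _ _
      rw [Pi.add_apply]; linarith
    have hw2 : ∀ i, 0 ≤ (A *ᵥ v + q) i := fun i => by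
      have : - (A *ᵥ v) i ≤ q i := le_max_right _ _
      rw [Pi.add_apply]; linarith
    have hsub : ({0, u, v} : Set (Fin n → ℝ)) ⊆ {z : Fin n → ℝ | (∀ i, 0 ≤ z i) ∧
        (∀ i, 0 ≤ (A.mulVec z + q) i) ∧ z ⬝ᵥ (A.mulVec z + q) = 0} := by
      rintro z (rfl | rfl | rfl)
      · refine ⟨by simp, fun i => ?_, by simp⟩
        simpa using (hqpos i).le
      · refine ⟨hup, hw1, (lcp_comp hup hw1).2 fun i => ?_⟩
        by_cases hi : 0 < x i
        · have h1 : (A *ᵥ x) i ≤ 0 := by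
            by_contra hc
            push Not at hc
            linarith [mul_pos hi hc, hx i]
          have h2 : q i = - (A *ᵥ u) i := max_eq_left (by linarith [hAx i])
          rw [h2]; ring
        · have : u i = 0 := max_eq_right (not_lt.1 hi)
          rw [this, zero_mul]
      · refine ⟨hvp, hw2, (lcp_comp hvp hw2).2 fun i => ?_⟩
        by_cases hi : x i < 0
        · have h1 : 0 ≤ (A *ᵥ x) i := by
            by_contra hc
            push Not at hc
            linarith [mul_pos_of_neg_of_neg hi hc, hx i]
          have h2 : q i = - (A *ᵥ v) i := max_eq_right (by linarith [hAx i])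
          rw [h2]; ring
        · have : v i = 0 := max_eq_right (by linarith)
          rw [this, zero_mul]
    have h3 : ({0, u, v} : Set (Fin n → ℝ)).ncard = 3 :=
      Set.ncard_eq_three.2 ⟨0, u, v, hu0.symm, hv0.symm, huv, rfl⟩
    have hle := Set.ncard_le_ncard hsub (Set.finite_of_ncard_ne_zero (by rw [hcard]; norm_num))
    omega
end

section
/- Let A be a real n×n N-matrix, let α be a nonempty proper subset of {1,…,n}, and let B = ppt(A, α) be the principal pivot transform of A relative to α, i.e., the n×n matrix determined blockwise (with ᾱ = {1,…,n}∖α) by B[α] = A[α]⁻¹, B[α, ᾱ] = −A[α]⁻¹ A[α, ᾱ], B[ᾱ, α] = A[ᾱ, α] A[α]⁻¹, and B[ᾱ] = A[ᾱ] − A[ᾱ, α] A[α]⁻¹ A[α, ᾱ]. Then det(B[α]) < 0 and det(B[β]) > 0 for every nonempty β ⊆ {1,…,n} with β ≠ α. -/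
open Matrix BigOperators

/-- Principal submatrix of `A` indexed by `β`. -/
def principalSub {n : ℕ} (A : Matrix (Fin n) (Fin n) ℝ) (β : Finset (Fin n)) :
    Matrix β β ℝ :=
  A.submatrix (fun i : β => (i : Fin n)) (fun j : β => (j : Fin n))

/-- The principal pivot transform of `A` relative to `α`, defined blockwise by
`B[α] = A[α]⁻¹`, `B[α,ᾱ] = -A[α]⁻¹A[α,ᾱ]`, `B[ᾱ,α] = A[ᾱ,α]A[α]⁻¹`, and
`B[ᾱ] = A[ᾱ] - A[ᾱ,α]A[α]⁻¹A[α,ᾱ]`. -/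
noncomputable def ppt {n : ℕ} (A : Matrix (Fin n) (Fin n) ℝ) (α : Finset (Fin n)) :
    Matrix (Fin n) (Fin n) ℝ :=
  Matrix.of fun i j =>
    if hi : i ∈ α then
      if hj : j ∈ α then (principalSub A α)⁻¹ ⟨i, hi⟩ ⟨j, hj⟩
      else -∑ p : α, (principalSub A α)⁻¹ ⟨i, hi⟩ p * A (p : Fin n) j
    else
      if hj : j ∈ α then ∑ p : α, A i (p : Fin n) * (principalSub A α)⁻¹ p ⟨j, hj⟩
      else A i j - ∑ p : α, ∑ q : α,
        A i (p : Fin n) * (principalSub A α)⁻¹ p q * A (q : Fin n) j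

/-- Rows in `S` come from `A`, other rows from the identity. -/
noncomputable def rowMix {n : ℕ} (A : Matrix (Fin n) (Fin n) ℝ) (S : Finset (Fin n)) :
    Matrix (Fin n) (Fin n) ℝ :=
  Matrix.of fun i j => if i ∈ S then A i j else (1 : Matrix (Fin n) (Fin n) ℝ) i j

lemma det_rowMix {n : ℕ} (A : Matrix (Fin n) (Fin n) ℝ) (S : Finset (Fin n)) :
    (rowMix A S).det = (principalSub A S).det := by
  rw [Matrix.twoBlockTriangular_det (rowMix A S) (fun i => i ∈ S)]
  · have h1 : (toSquareBlockProp (rowMix A S) (fun i => i ∈ S)) = principalSub A S := by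
      ext i j
      have hi : (i : Fin n) ∈ S := i.2
      simp [toSquareBlockProp, rowMix, principalSub, hi]
    have h2 : (toSquareBlockProp (rowMix A S) (fun i => ¬ i ∈ S)) = 1 := by
      ext i j
      have hi : (i : Fin n) ∉ S := i.2
      simp [toSquareBlockProp, rowMix, hi, Matrix.one_apply, Subtype.ext_iff]
    rw [h2, det_one, mul_one]
    rw [← h1]
    congr!
  · intro i hi j hj
    have : i ≠ j := fun h => hi (h ▸ hj)
    simp [rowMix, hi, this]

lemma sum_rowMix {n : ℕ} (A : Matrix (Fin n) (Fin n) ℝ) (α : Finset (Fin n))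
    (f : Fin n → ℝ) (j : Fin n) :
    ∑ k, f k * rowMix A α k j = ∑ p : α, f p * A p j + if j ∈ α then 0 else f j := by
  rw [Finset.sum_coe_sort α (fun p => f p * A p j), ← Finset.sum_add_sum_compl α]
  congr 1
  · apply Finset.sum_congr rfl
    intro k hk
    simp [rowMix, hk]
  · have : ∀ k ∈ αᶜ, f k * rowMix A α k j = if k = j then f k else 0 := by
      intro k hk
      have hk : k ∉ α := by simpa using hk
      simp [rowMix, hk, Matrix.one_apply]
    rw [Finset.sum_congr rfl this, Finset.sum_ite_eq']
    by_cases hj : j ∈ α <;> simp [hj]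

lemma ppt_mul_rowMix {n : ℕ} (A : Matrix (Fin n) (Fin n) ℝ) (α : Finset (Fin n))
    (h : (principalSub A α).det ≠ 0) : ppt A α * rowMix A α = rowMix A αᶜ := by
  have hinv : (principalSub A α)⁻¹ * principalSub A α = 1 :=
    Matrix.nonsing_inv_mul _ (isUnit_iff_ne_zero.mpr h)
  have hinv' : ∀ (p : α) (j : Fin n) (hj : j ∈ α),
      ∑ q : α, (principalSub A α)⁻¹ p q * A q j = (1 : Matrix α α ℝ) p ⟨j, hj⟩ := by
    intro p j hj
    rw [← hinv, Matrix.mul_apply]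
    rfl
  ext i j
  rw [Matrix.mul_apply, sum_rowMix]
  by_cases hi : i ∈ α
  · have e : ∀ p : α, ppt A α i p = (principalSub A α)⁻¹ ⟨i, hi⟩ p := by
      intro p; simp [ppt, hi]
    simp only [e]
    by_cases hj : j ∈ α
    · rw [hinv' _ _ hj]
      simp [rowMix, hi, hj, Matrix.one_apply]
    · have : i ≠ j := fun h => hj (h ▸ hi)
      simp [ppt, rowMix, hi, hj, this]
  · have e : ∀ p : α, ppt A α i p = ∑ q : α, A i q * (principalSub A α)⁻¹ q p := by
      intro p; simp [ppt, hi]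
    have e2 : ∑ p : α, ppt A α i p * A p j
        = ∑ q : α, A i q * ∑ p : α, (principalSub A α)⁻¹ q p * A p j := by
      simp only [e, Finset.sum_mul, Finset.mul_sum]
      rw [Finset.sum_comm]
      simp only [mul_assoc]
    rw [e2]
    by_cases hj : j ∈ α
    · simp only [hinv' _ _ hj]
      simp [rowMix, hi, hj, Matrix.one_apply]
    · simp [ppt, rowMix, hi, hj, Finset.mul_sum, mul_assoc]

lemma ppt_minor {n : ℕ} (A : Matrix (Fin n) (Fin n) ℝ) (α β : Finset (Fin n))
    (h : (principalSub A α).det ≠ 0) :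
    (principalSub (ppt A α) β).det * (principalSub A α).det
      = (principalSub A (symmDiff α β)).det := by
  rw [← det_rowMix, ← det_rowMix, ← det_rowMix, ← det_mul]
  congr 1
  ext i j
  by_cases hi : i ∈ β
  · have : (rowMix (ppt A α) β * rowMix A α) i j = (ppt A α * rowMix A α) i j := by
      simp [Matrix.mul_apply, rowMix, hi]
    rw [this, ppt_mul_rowMix A α h]
    simp [rowMix, Finset.mem_symmDiff, hi]
  · have : (rowMix (ppt A α) β * rowMix A α) i j = 
      ((1 : Matrix (Fin n) (Fin n) ℝ) * rowMix A α) i j := by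
      rw [Matrix.mul_apply, Matrix.mul_apply]
      simp only [rowMix, hi, Matrix.of_apply, if_false]
    rw [this, one_mul]
    simp [rowMix, Finset.mem_symmDiff, hi]

/-- [N5]: if `A` is an N-matrix and `α` is a nonempty proper subset of indices,
then for `B = ppt(A, α)` one has `det B[α] < 0` while every other principal
minor of `B` is positive. -/
theorem stmt_11 {n : ℕ} (A : Matrix (Fin n) (Fin n) ℝ) (hA : IsNMatrix A)
    (α : Finset (Fin n)) (hα : α.Nonempty) (hprop : α ≠ Finset.univ) :
    (principalSub (ppt A α) α).det < 0 ∧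
    ∀ β : Finset (Fin n), β.Nonempty → β ≠ α →
      0 < (principalSub (ppt A α) β).det := by
  have hd : (principalSub A α).det < 0 := hA α hα
  constructor
  · have h := ppt_minor A α α hd.ne
    rw [symmDiff_self, ← det_rowMix A ⊥] at h
    have h1 : rowMix A ⊥ = 1 := by
      ext i j
      simp [rowMix]
    rw [h1, det_one] at h
    nlinarith
  · intro β _ hne
    have h := ppt_minor A α β hd.ne
    have hs : (principalSub A (symmDiff α β)).det < 0 := by
      apply hA
      rw [Finset.nonempty_iff_ne_empty]
      intro h0
      exact hne (symmDiff_eq_bot.mp h0).symm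
    nlinarith
end
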